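/- For each n ≥ 1 let 𝓜_n denote the set of pairs (F, M) where F is an acyclic simple graph (forest) on the vertex set Fin n and M is a maximal matching of F, let m_n = |𝓜_n|, let Ē_n = (Σ_{(F,M) ∈ 𝓜_n} |M|) / m_n, and let V̄_n = (Σ_{(F,M) ∈ 𝓜_n} |M|²) / m_n − Ē_n² be the variance of the number of edges of a uniformly random element of 𝓜_n. Then there exist real constants σ₂² > 0 and K ≥ 0 such that |V̄_n − σ₂²·n| ≤ K for all n ≥ 1. -/

import Mathlib

open Filter Topology MeasureTheory

/-- `M` is a matching of `G`: a set of edges of `G`, no two distinct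
edges of which share a vertex. -/
def IsMatching {V : Type*} (G : SimpleGraph V) (M : Set (Sym2 V)) : Prop :=
  M ⊆ G.edgeSet ∧ ∀ e ∈ M, ∀ f ∈ M, e ≠ f → ∀ v : V, v ∈ e → v ∉ f

/-- `M` is a maximal matching of `G`. -/
def IsMaximalMatching {V : Type*} (G : SimpleGraph V) (M : Set (Sym2 V)) : Prop :=
  IsMatching G M ∧ ∀ M' : Set (Sym2 V), IsMatching G M' → ¬ M ⊂ M'

/-- The pairs `(F, M)` where `F` is a forest (acyclic simple graph) on `Fin n`
and `M` is a maximal matching of `F`. -/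
def MMSpace (n : ℕ) :=
  {p : SimpleGraph (Fin n) × Set (Sym2 (Fin n)) // p.1.IsAcyclic ∧ IsMaximalMatching p.1 p.2}

/-- `mN n` is the number of pairs `(F, M)` where `F` is a forest on `Fin n`
and `M` is a maximal matching of `F`. -/
noncomputable def mN (n : ℕ) : ℕ := Nat.card (MMSpace n)

/-- The expected number of edges of a uniformly random maximal matching–forest
pair on `n` vertices: the arithmetic mean of `|M|` over all pairs `(F, M)`. -/
noncomputable def Ebar (n : ℕ) : ℝ :=
  (∑ᶠ p : MMSpace n, (p.val.2.ncard : ℝ)) / (mN n : ℝ)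


/-- The variance of the number of edges of a uniformly random maximal
matching–forest pair on `n` vertices. -/
noncomputable def Vbar (n : ℕ) : ℝ :=
  (∑ᶠ p : MMSpace n, (p.val.2.ncard : ℝ) ^ 2) / (mN n : ℝ) - (Ebar n) ^ 2

/-! ### Forests with separated roots -/

section Forest

variable {α : Type*}

/-- A set of vertices closed under adjacency contains everything reachable from it. -/
lemma mem_of_reachable_of_closed {G : SimpleGraph α} {K : Set α}
    (hK : ∀ a b, a ∈ K → G.Adj a b → b ∈ K) {u v : α} (hu : u ∈ K) (h : G.Reachable u v) :
    v ∈ K := by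
  obtain ⟨p⟩ := h
  induction p with
  | nil => exact hu
  | cons h _ ih => exact ih (hK _ _ hu h)

/-- The vertices of `R` lie in pairwise distinct components of the forest `G`. -/
def SeparatedForest (G : SimpleGraph α) (R : Set α) : Prop :=
  G.IsAcyclic ∧ ∀ u ∈ R, ∀ v ∈ R, u ≠ v → ¬ G.Reachable u v

/-- The star joining `r` to all vertices of `J`. -/
def starOn (r : α) (J : Set α) : SimpleGraph α where
  Adj u v := u ≠ v ∧ ((u = r ∧ v ∈ J) ∨ (v = r ∧ u ∈ J))
  symm := ⟨fun _ _ h => ⟨h.1.symm, h.2.symm⟩⟩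
  loopless := ⟨fun _ h => h.1 rfl⟩

lemma SeparatedForest.sdiff_starOn {G : SimpleGraph α} {R J : Set α} {r : α} (hr : r ∈ R)
    (h : SeparatedForest G R) (hJ : ∀ j ∈ J, G.Adj r j) :
    SeparatedForest (G \ starOn r J) (R ∪ J) := by
  obtain ⟨hac, hsep⟩ := h
  have hle : G \ starOn r J ≤ G := sdiff_le
  have hbr : ∀ j ∈ J, ¬ (G.deleteEdges {s(r, j)}).Reachable r j := fun j hj =>
    SimpleGraph.isBridge_iff.1 (SimpleGraph.isAcyclic_iff_forall_adj_isBridge.1 hac (hJ j hj))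
  have hdel : ∀ j ∈ J, G \ starOn r J ≤ G.deleteEdges {s(r, j)} := by
    intro j hj a b hab
    have hne : r ≠ j := (hJ j hj).ne
    simp only [SimpleGraph.sdiff_adj, starOn] at hab
    simp only [SimpleGraph.deleteEdges_adj, Set.mem_singleton_iff, Sym2.eq_iff]
    grind
  have hRJ : ∀ w ∈ R, ∀ j ∈ J, ¬ (G \ starOn r J).Reachable w j := by
    intro w hw j hj hreach
    by_cases hwr : w = r
    · subst hwr
      exact hbr j hj (hreach.mono (hdel j hj))
    · exact hsep w hw r hr hwr ((hreach.mono hle).trans (hJ j hj).symm.reachable)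
  refine ⟨hac.anti hle, ?_⟩
  rintro u (hu | hu) v (hv | hv) huv hreach
  · exact hsep u hu v hv huv (hreach.mono hle)
  · exact hRJ u hu v hv hreach
  · exact hRJ v hv u hu hreach.symm
  · refine hbr u hu ((hreach.mono (hdel u hu)).trans ?_).symm
    refine SimpleGraph.Adj.reachable ?_
    have h1 := hJ v hv
    have h2 := h1.ne
    simp only [SimpleGraph.deleteEdges_adj, Set.mem_singleton_iff, Sym2.eq_iff]
    exact ⟨h1.symm, by grind⟩

lemma SeparatedForest.sup_starOn {G : SimpleGraph α} {R J : Set α} {r : α} (hr : r ∈ R)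
    (hRJ : Disjoint R J) (h : SeparatedForest G (R ∪ J)) :
    SeparatedForest (G ⊔ starOn r J) R := by
  obtain ⟨hac, hsep⟩ := h
  have hrJ : r ∉ J := fun h => Set.disjoint_left.1 hRJ hr h
  refine ⟨?_, ?_⟩
  · rw [SimpleGraph.isAcyclic_iff_forall_adj_isBridge]
    have hstar : ∀ j ∈ J, ((G ⊔ starOn r J).deleteEdges {s(r, j)}).Reachable j r → False := by
      intro j hj hreach
      have := mem_of_reachable_of_closed (K := {w | G.Reachable j w}) ?_
        (SimpleGraph.Reachable.refl j) hreach
      · exact hsep j (Or.inr hj) r (Or.inl hr) (by grind) this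
      · intro a b ha hab
        simp only [SimpleGraph.deleteEdges_adj, SimpleGraph.sup_adj, starOn,
          Set.mem_singleton_iff, Sym2.eq_iff] at hab
        obtain ⟨hab | ⟨hne, ⟨rfl, hb⟩ | ⟨rfl, ha'⟩⟩, hdel⟩ := hab
        · exact SimpleGraph.Reachable.trans ha hab.reachable
        · exact (hsep j (Or.inr hj) a (Or.inl hr) (by grind) ha).elim
        · exact (hsep j (Or.inr hj) a (Or.inr ha') (by grind) ha).elim
    intro u v huv
    rw [SimpleGraph.isBridge_iff]
    intro hreach
    simp only [SimpleGraph.sup_adj] at huv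
    rcases huv with huv | ⟨hne, ⟨rfl, hv⟩ | ⟨rfl, hu⟩⟩
    · have hb := SimpleGraph.isBridge_iff.1
        (SimpleGraph.isAcyclic_iff_forall_adj_isBridge.1 hac huv)
      have key : ∀ x y, s(x, y) = s(u, v) →
          ((G ⊔ starOn r J).deleteEdges {s(u, v)}).Reachable x y →
          ¬ (G.deleteEdges {s(u, v)}).Reachable x y →
          ∃ a, (G.deleteEdges {s(u, v)}).Reachable x a ∧ (a = r ∨ a ∈ J) := by
        intro x y hxy hre hnot
        by_contra! hcon
        refine hnot (mem_of_reachable_of_closed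
          (K := {w | (G.deleteEdges {s(u, v)}).Reachable x w}) ?_
          (SimpleGraph.Reachable.refl x) hre)
        intro a b ha hab
        obtain ⟨h1, h2⟩ := hcon a ha
        simp only [SimpleGraph.deleteEdges_adj, SimpleGraph.sup_adj, starOn] at hab
        obtain ⟨hab | hab, hdel⟩ := hab
        · exact SimpleGraph.Reachable.trans ha
            (SimpleGraph.Adj.reachable (SimpleGraph.deleteEdges_adj.2 ⟨hab, hdel⟩))
        · grind
      obtain ⟨a, ha, ha'⟩ := key u v rfl hreach hb
      obtain ⟨b, hb1, hb'⟩ := key v u Sym2.eq_swap hreach.symm (fun h => hb h.symm)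
      by_cases hab : a = b
      · subst hab
        exact hb (ha.trans hb1.symm)
      · refine hsep a (by grind) b (by grind) hab ?_
        have hle := SimpleGraph.deleteEdges_le (G := G) {s(u, v)}
        exact ((ha.mono hle).symm.trans huv.reachable).trans (hb1.mono hle)
    · exact hstar v hv hreach.symm
    · rw [Sym2.eq_swap] at hreach
      exact hstar u hu hreach
  · have key : ∀ u ∈ R, ∀ v ∈ R, u ≠ r → u ≠ v → ¬ (G ⊔ starOn r J).Reachable u v := by
      intro u hu v hv hur huv hreach
      refine hsep u (Or.inl hu) v (Or.inl hv) huv (mem_of_reachable_of_closed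
        (K := {w | G.Reachable u w}) ?_ (SimpleGraph.Reachable.refl u) hreach)
      intro a b ha hab
      simp only [SimpleGraph.sup_adj, starOn] at hab
      obtain hab | ⟨hne, ⟨rfl, hb⟩ | ⟨rfl, ha'⟩⟩ := hab
      · exact SimpleGraph.Reachable.trans ha hab.reachable
      · exact (hsep u (Or.inl hu) a (Or.inl hr) hur ha).elim
      · refine (hsep u (Or.inl hu) a (Or.inr ha') ?_ ha).elim
        rintro rfl
        exact Set.disjoint_left.1 hRJ hu ha'
    intro u hu v hv huv hreach
    by_cases hur : u = r
    · exact key v hv u hu (by grind) huv.symm hreach.symm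
    · exact key u hu v hv hur huv hreach

end Forest

/-! ### Partially explored configurations -/

section Configurations

/-- The state of a vertex during the exploration of a forest with a matching:
not yet reached; a root that is unmatched; a root matched to an unexplored vertex;
a root whose partner has been explored; completely explored. -/
inductive VertexState
  | free | unmatched | matched | half | dead
  deriving DecidableEq

open VertexState

variable {α : Type*}

/-- A vertex is covered when it is an end of a matching edge, explored or not. -/
def Covered (τ : α → VertexState) (M : Set (Sym2 α)) (u : α) : Prop :=
  τ u = half ∨ ∃ e ∈ M, u ∈ e

/-- `F` and `M` are a forest and a maximal matching of its unexplored part, compatible with the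
vertex states `τ`. -/
structure Config (τ : α → VertexState) (F : SimpleGraph α) (M : Set (Sym2 α)) : Prop where
  sep : SeparatedForest F {v | τ v ≠ free}
  sub : M ⊆ F.edgeSet
  disj : ∀ e ∈ M, ∀ f ∈ M, ∀ v, v ∈ e → v ∈ f → e = f
  isolated : ∀ v w, τ v = dead → ¬ F.Adj v w
  avoid_unmatched : ∀ v, τ v = unmatched → ∀ e ∈ M, v ∉ e
  avoid_half : ∀ v, τ v = half → ∀ e ∈ M, v ∉ e
  meets_matched : ∀ v, τ v = matched → ∃ e ∈ M, v ∈ e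
  cover : ∀ u v, F.Adj u v → Covered τ M u ∨ Covered τ M v

/-- Without roots, configurations are exactly the maximal matchings of forests. -/
lemma config_free_iff {F : SimpleGraph α} {M : Set (Sym2 α)} :
    Config (fun _ => free) F M ↔ F.IsAcyclic ∧ IsMaximalMatching F M := by
  constructor
  · intro h
    refine ⟨h.sep.1, ⟨h.sub, fun e he f hf hne v hve hvf => hne (h.disj e he f hf v hve hvf)⟩, ?_⟩
    intro M' hM' hlt
    obtain ⟨e, he', he⟩ := Set.exists_of_ssubset hlt
    induction e using Sym2.ind with
    | _ u v =>
    have hadj : F.Adj u v := hM'.1 he'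
    rcases h.cover u v hadj with h1 | h1 <;>
    · obtain ⟨f, hf, hvf⟩ := h1.resolve_left (by simp)
      refine hM'.2 _ he' f (hlt.1 hf) ?_ _ ?_ hvf
      · rintro rfl
        exact he hf
      · simp
  · rintro ⟨hF, hM, hmax⟩
    refine ⟨⟨hF, by simp⟩, hM.1, ?_, by simp, by simp, by simp, by simp, ?_⟩
    · intro e he f hf v hve hvf
      by_contra hne
      exact hM.2 e he f hf hne v hve hvf
    · intro u v hadj
      by_contra hcon
      push Not at hcon
      simp only [Covered, reduceCtorEq, false_or, not_exists, not_and] at hcon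
      obtain ⟨h1, h2⟩ := hcon
      refine hmax (insert s(u, v) M) ⟨?_, ?_⟩ ?_
      · rintro e (rfl | he)
        · exact hadj
        · exact hM.1 he
      · rintro e he f hf hne w hwe hwf
        rcases he with rfl | he <;> rcases hf with rfl | hf
        · exact hne rfl
        · rcases Sym2.mem_iff.1 hwe with rfl | rfl
          · exact h1 f hf hwf
          · exact h2 f hf hwf
        · rcases Sym2.mem_iff.1 hwf with rfl | rfl
          · exact h1 e he hwe
          · exact h2 e he hwe
        · exact hM.2 e he f hf hne w hwe hwf
      · exact Set.ssubset_insert fun hmem => h1 _ hmem (by simp)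

section Relabel

variable [DecidableEq α]

/-- Change the state of `r` to `a` and that of all elements of `J` to `b`. -/
def relabel (τ : α → VertexState) (r : α) (J : Finset α) (a b : VertexState) : α → VertexState :=
  fun v => if v = r then a else if v ∈ J then b else τ v

lemma ofPred_relabel_ne_free {τ : α → VertexState} {r : α} {J : Finset α} {a b : VertexState}
    (hr : τ r ≠ free) (ha : a ≠ free) (hb : b ≠ free) :
    {v | relabel τ r J a b v ≠ free} = {v | τ v ≠ free} ∪ J := by
  ext v
  simp only [relabel, Set.mem_ofPred_eq, Set.mem_union, Finset.mem_coe]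
  grind

end Relabel

lemma SeparatedForest.not_adj {F : SimpleGraph α} {R : Set α} (h : SeparatedForest F R) {u v : α}
    (hu : u ∈ R) (hv : v ∈ R) : ¬ F.Adj u v :=
  fun hadj => h.2 u hu v hv hadj.ne hadj.reachable

lemma Config.free_of_adj {τ : α → VertexState} {F : SimpleGraph α} {M : Set (Sym2 α)}
    (h : Config τ F M) {r v : α} (hr : τ r ≠ free) (hv : F.Adj r v) : τ v = free := by
  by_contra hne
  exact h.sep.not_adj hr hne hv

lemma starOn_le {F : SimpleGraph α} {r : α} {J : Set α} (h : ∀ j ∈ J, F.Adj r j) :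
    starOn r J ≤ F := by
  rintro a b ⟨-, ⟨rfl, hb⟩ | ⟨rfl, ha⟩⟩
  · exact h b hb
  · exact (h a ha).symm

lemma SeparatedForest.disjoint_starOn {F : SimpleGraph α} {R J : Set α} {r : α} (hr : r ∈ R)
    (h : SeparatedForest F (R ∪ J)) : Disjoint F (starOn r J) := by
  rw [disjoint_iff_inf_le]
  rintro a b ⟨hab, -, ⟨rfl, hb⟩ | ⟨rfl, ha⟩⟩
  · exact h.not_adj (Or.inl hr) (Or.inr hb) hab
  · exact h.not_adj (Or.inr ha) (Or.inl hr) hab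

lemma sup_sdiff_starOn {F : SimpleGraph α} {R J : Set α} {r : α} (hr : r ∈ R)
    (h : SeparatedForest F (R ∪ J)) : (F ⊔ starOn r J) \ starOn r J = F := by
  rw [sup_sdiff_right_self]
  exact (h.disjoint_starOn hr).sdiff_eq_left

lemma sub_sdiff_starOn {F : SimpleGraph α} {M : Set (Sym2 α)} {r : α} (J : Set α)
    (hM : M ⊆ F.edgeSet) (hr : ∀ e ∈ M, r ∉ e) : M ⊆ (F \ starOn r J).edgeSet := by
  intro e he
  have h1 := hM he
  have h2 := hr e he
  induction e with | h a b =>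
  simp only [SimpleGraph.mem_edgeSet, SimpleGraph.sdiff_adj, starOn, Sym2.mem_iff] at h1 h2 ⊢
  grind

variable [DecidableEq α]

section Unmatched

variable {τ : α → VertexState} {F : SimpleGraph α} {M : Set (Sym2 α)} {r : α} {J : Finset α}

lemma Config.explore_unmatched (h : Config τ F M) (hr : τ r = unmatched)
    (hJ : ∀ v, v ∈ J ↔ F.Adj r v) :
    Config (relabel τ r J .dead .matched) (F \ starOn r J) M := by
  have hfree : ∀ j ∈ J, τ j = free := fun j hj => h.free_of_adj (by simp [hr]) ((hJ j).1 hj)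
  have hrJ : r ∉ J := fun hj => by simpa [hr] using hfree r hj
  have hcov : ∀ u, Covered τ M u → Covered (relabel τ r J .dead .matched) M u := by
    rintro u (hu | hu)
    · left
      simp only [relabel]
      grind
    · exact Or.inr hu
  constructor
  · rw [ofPred_relabel_ne_free (by simp [hr]) (by simp) (by simp)]
    exact h.sep.sdiff_starOn (by simp [hr]) (fun j hj => (hJ j).1 hj)
  · exact sub_sdiff_starOn _ h.sub (h.avoid_unmatched r hr)
  · exact h.disj
  · intro v w hv
    by_cases hvr : v = r
    · subst hvr
      simp only [SimpleGraph.sdiff_adj, starOn, not_and, Finset.mem_coe]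
      intro hadj hstar
      exact hstar hadj.ne (Or.inl ⟨trivial, (hJ w).2 hadj⟩)
    · have : τ v = dead := by
        simp only [relabel] at hv
        grind
      exact fun hadj => h.isolated v w this hadj.1
  · intro v hv
    refine h.avoid_unmatched v ?_
    simp only [relabel] at hv
    grind
  · intro v hv
    refine h.avoid_half v ?_
    simp only [relabel] at hv
    grind
  · intro v hv
    by_cases hvJ : v ∈ J
    · rcases h.cover r v ((hJ v).1 hvJ) with (h1 | ⟨e, he, h1⟩) | (h1 | h1)
      · simp [hr] at h1
      · exact (h.avoid_unmatched r hr e he h1).elim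
      · simp [hfree v hvJ] at h1
      · exact h1
    · refine h.meets_matched v ?_
      simp only [relabel] at hv
      grind
  · intro u v huv
    exact (h.cover u v huv.1).imp (hcov u) (hcov v)

lemma Config.unexplore_unmatched (hr : τ r = unmatched) (hJ : ∀ j ∈ J, τ j = free)
    (h : Config (relabel τ r J .dead .matched) F M) :
    Config τ (F ⊔ starOn r J) M ∧ (∀ v, v ∈ J ↔ (F ⊔ starOn r J).Adj r v) ∧
      (F ⊔ starOn r J) \ starOn r J = F := by
  have hrJ : r ∉ J := fun hj => by simpa [hr] using hJ r hj
  have hrd : relabel τ r J .dead .matched r = dead := by simp [relabel]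
  have hsep := h.sep
  rw [ofPred_relabel_ne_free (by simp [hr]) (by simp) (by simp)] at hsep
  have hrM : ∀ e ∈ M, r ∉ e := by
    intro e he hre
    have := h.sub he
    obtain ⟨w, rfl⟩ := hre
    exact h.isolated r w hrd this
  have hcov : ∀ u, Covered (relabel τ r J .dead .matched) M u → Covered τ M u := by
    rintro u (hu | hu)
    · left
      simp only [relabel] at hu
      grind
    · exact Or.inr hu
  refine ⟨?_, ?_, sup_sdiff_starOn (by simp [hr]) hsep⟩
  · constructor
    · refine hsep.sup_starOn (by simp [hr]) ?_
      rw [Set.disjoint_left]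
      intro v hv hvJ
      exact hv (hJ v hvJ)
    · exact h.sub.trans (SimpleGraph.edgeSet_mono le_sup_left)
    · exact h.disj
    · rintro v w hv (hadj | ⟨-, ⟨rfl, -⟩ | ⟨rfl, hvJ⟩⟩)
      · refine h.isolated v w ?_ hadj
        simp only [relabel]
        grind
      · simp [hr] at hv
      · simp [hJ v hvJ] at hv
    · intro v hv e he
      by_cases hvr : v = r
      · exact hvr ▸ hrM e he
      · refine h.avoid_unmatched v ?_ e he
        simp only [relabel]
        grind
    · intro v hv
      refine h.avoid_half v ?_
      simp only [relabel]
      grind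
    · intro v hv
      refine h.meets_matched v ?_
      simp only [relabel]
      grind
    · rintro u v (hadj | ⟨-, ⟨rfl, hvJ⟩ | ⟨rfl, huJ⟩⟩)
      · exact (h.cover u v hadj).imp (hcov u) (hcov v)
      · refine Or.inr (Or.inr (h.meets_matched v ?_))
        simp only [relabel]
        grind
      · refine Or.inl (Or.inr (h.meets_matched u ?_))
        simp only [relabel]
        grind
  · intro v
    simp only [SimpleGraph.sup_adj, starOn, Finset.mem_coe]
    constructor
    · intro hv
      exact Or.inr ⟨by grind, Or.inl ⟨trivial, hv⟩⟩
    · rintro (hadj | ⟨-, ⟨-, hv⟩ | ⟨-, hv⟩⟩)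
      · exact (h.isolated r v hrd hadj).elim
      · exact hv
      · exact (hrJ hv).elim

end Unmatched

section Half

variable {τ : α → VertexState} {F : SimpleGraph α} {M : Set (Sym2 α)} {r : α} {J : Finset α}

lemma Config.explore_half (h : Config τ F M) (hr : τ r = half)
    (hJ : ∀ v, v ∈ J ↔ F.Adj r v ∧ ∀ e ∈ M, v ∉ e) :
    Config (relabel τ r J .unmatched .unmatched) (F \ starOn r J) M := by
  have hfree : ∀ j ∈ J, τ j = free := fun j hj => h.free_of_adj (by simp [hr]) ((hJ j).1 hj).1
  have hrJ : r ∉ J := fun hj => by simpa [hr] using hfree r hj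
  have hcov : ∀ u, u ≠ r → Covered τ M u →
      Covered (relabel τ r J .unmatched .unmatched) M u := by
    rintro u hur (hu | hu)
    · left
      simp only [relabel]
      grind
    · exact Or.inr hu
  have hcovr : ∀ v, (F \ starOn r J).Adj r v →
      Covered (relabel τ r J .unmatched .unmatched) M v := by
    rintro v ⟨hadj, hstar⟩
    right
    by_contra! hcon
    exact hstar ⟨hadj.ne, Or.inl ⟨rfl, (hJ v).2 ⟨hadj, hcon⟩⟩⟩
  constructor
  · rw [ofPred_relabel_ne_free (by simp [hr]) (by simp) (by simp)]
    exact h.sep.sdiff_starOn (by simp [hr]) (fun j hj => ((hJ j).1 hj).1)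
  · exact sub_sdiff_starOn _ h.sub (h.avoid_half r hr)
  · exact h.disj
  · intro v w hv
    have : τ v = dead := by
      simp only [relabel] at hv
      grind
    exact fun hadj => h.isolated v w this hadj.1
  · intro v hv e he
    by_cases hvr : v = r
    · exact hvr ▸ h.avoid_half r hr e he
    by_cases hvJ : v ∈ J
    · exact ((hJ v).1 hvJ).2 e he
    refine h.avoid_unmatched v ?_ e he
    simp only [relabel] at hv
    grind
  · intro v hv
    refine h.avoid_half v ?_
    simp only [relabel] at hv
    grind
  · intro v hv
    refine h.meets_matched v ?_
    simp only [relabel] at hv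
    grind
  · intro u v huv
    by_cases hur : u = r
    · subst hur
      exact Or.inr (hcovr v huv)
    by_cases hvr : v = r
    · subst hvr
      exact Or.inl (hcovr u huv.symm)
    exact (h.cover u v huv.1).imp (hcov u hur) (hcov v hvr)

lemma Config.unexplore_half (hr : τ r = half) (hJ : ∀ j ∈ J, τ j = free)
    (h : Config (relabel τ r J .unmatched .unmatched) F M) :
    Config τ (F ⊔ starOn r J) M ∧
      (∀ v, v ∈ J ↔ (F ⊔ starOn r J).Adj r v ∧ ∀ e ∈ M, v ∉ e) ∧
      (F ⊔ starOn r J) \ starOn r J = F := by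
  have hrJ : r ∉ J := fun hj => by simpa [hr] using hJ r hj
  have hru : relabel τ r J .unmatched .unmatched r = .unmatched := by simp [relabel]
  have hJu : ∀ v ∈ J, relabel τ r J .unmatched .unmatched v = .unmatched := by
    intro v hv
    simp [relabel, hv]
  have hsep := h.sep
  rw [ofPred_relabel_ne_free (by simp [hr]) (by simp) (by simp)] at hsep
  have hcov : ∀ u, Covered (relabel τ r J .unmatched .unmatched) M u → Covered τ M u := by
    rintro u (hu | hu)
    · left
      simp only [relabel] at hu
      grind
    · exact Or.inr hu
  refine ⟨?_, ?_, sup_sdiff_starOn (by simp [hr]) hsep⟩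
  · constructor
    · refine hsep.sup_starOn (by simp [hr]) ?_
      rw [Set.disjoint_left]
      intro v hv hvJ
      exact hv (hJ v hvJ)
    · exact h.sub.trans (SimpleGraph.edgeSet_mono le_sup_left)
    · exact h.disj
    · rintro v w hv (hadj | ⟨-, ⟨rfl, -⟩ | ⟨rfl, hvJ⟩⟩)
      · refine h.isolated v w ?_ hadj
        simp only [relabel]
        grind
      · simp [hr] at hv
      · simp [hJ v hvJ] at hv
    · intro v hv
      refine h.avoid_unmatched v ?_
      simp only [relabel]
      grind
    · intro v hv
      by_cases hvr : v = r
      · exact hvr ▸ h.avoid_unmatched r hru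
      refine h.avoid_half v ?_
      simp only [relabel]
      grind
    · intro v hv
      refine h.meets_matched v ?_
      simp only [relabel]
      grind
    · rintro u v (hadj | ⟨-, ⟨rfl, hvJ⟩ | ⟨rfl, huJ⟩⟩)
      · exact (h.cover u v hadj).imp (hcov u) (hcov v)
      · exact Or.inl (Or.inl hr)
      · exact Or.inr (Or.inl hr)
  · intro v
    simp only [SimpleGraph.sup_adj, starOn, Finset.mem_coe]
    constructor
    · intro hv
      exact ⟨Or.inr ⟨by grind, Or.inl ⟨trivial, hv⟩⟩, h.avoid_unmatched v (hJu v hv)⟩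
    · rintro ⟨hadj | ⟨-, ⟨-, hv⟩ | ⟨-, hv⟩⟩, hvM⟩
      · rcases h.cover r v hadj with (h1 | ⟨e, he, h1⟩) | (h1 | ⟨e, he, h1⟩)
        · simp [hru] at h1
        · exact (h.avoid_unmatched r hru e he h1).elim
        · exfalso
          refine hsep.not_adj (u := r) (v := v) (Or.inl (by simp [hr])) (Or.inl ?_) hadj
          simp only [relabel] at h1
          simp only [Set.mem_ofPred_eq]
          grind
        · exact (hvM e he h1).elim
      · exact hv
      · exact (hrJ hv).elim

end Half

section Matched

variable {τ : α → VertexState} {F : SimpleGraph α} {M : Set (Sym2 α)} {r p : α}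

lemma Config.explore_matched (h : Config τ F M) (hr : τ r = matched) (hp : s(r, p) ∈ M) :
    Config (relabel τ r {p} .half .half) (F \ starOn r {p}) (M \ {s(r, p)}) := by
  have hadj : F.Adj r p := h.sub hp
  have hfree : τ p = free := h.free_of_adj (by simp [hr]) hadj
  have hcov : ∀ u, Covered τ M u →
      Covered (relabel τ r {p} .half .half) (M \ {s(r, p)}) u := by
    rintro u (hu | ⟨e, he, hu⟩)
    · left
      simp only [relabel]
      grind
    · by_cases hee : e = s(r, p)
      · left
        subst hee
        simp only [Sym2.mem_iff] at hu
        simp only [relabel, Finset.mem_singleton]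
        grind
      · exact Or.inr ⟨e, ⟨he, hee⟩, hu⟩
  constructor
  · rw [ofPred_relabel_ne_free (by simp [hr]) (by simp) (by simp)]
    rw [Finset.coe_singleton]
    exact h.sep.sdiff_starOn (by simp [hr]) (by simpa using hadj)
  · rintro e ⟨he, hne⟩
    have := h.sub he
    induction e with | h a b =>
    simp only [SimpleGraph.mem_edgeSet, SimpleGraph.sdiff_adj, starOn] at this ⊢
    simp only [Set.mem_singleton_iff, Sym2.eq_iff] at hne ⊢
    grind
  · intro e he f hf
    exact h.disj e he.1 f hf.1
  · intro v w hv
    have : τ v = dead := by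
      simp only [relabel] at hv
      grind
    exact fun hadj => h.isolated v w this hadj.1
  · intro v hv e he
    refine h.avoid_unmatched v ?_ e he.1
    simp only [relabel] at hv
    grind
  · intro v hv e he hve
    by_cases hvr : v ∈ s(r, p)
    · exact he.2 (h.disj e he.1 _ hp v hve hvr)
    · refine h.avoid_half v ?_ e he.1 hve
      simp only [Sym2.mem_iff] at hvr
      simp only [relabel, Finset.mem_singleton] at hv
      grind
  · intro v hv
    have hv' : v ≠ r ∧ v ≠ p ∧ τ v = .matched := by
      simp only [relabel, Finset.mem_singleton] at hv
      grind
    obtain ⟨e, he, hve⟩ := h.meets_matched v hv'.2.2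
    refine ⟨e, ⟨he, ?_⟩, hve⟩
    rintro rfl
    simp only [Sym2.mem_iff] at hve
    grind
  · intro u v huv
    exact (h.cover u v huv.1).imp (hcov u) (hcov v)

lemma Config.unexplore_matched (hr : τ r = matched) (hp : τ p = free)
    (h : Config (relabel τ r {p} .half .half) F M) :
    Config τ (F ⊔ starOn r {p}) (insert s(r, p) M) ∧
      (F ⊔ starOn r {p}) \ starOn r {p} = F ∧ s(r, p) ∉ M := by
  have hrp : r ≠ p := by
    rintro rfl
    simp [hr] at hp
  have hrh : relabel τ r {p} .half .half r = .half := by simp [relabel]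
  have hph : relabel τ r {p} .half .half p = .half := by simp [relabel]
  have hsep := h.sep
  rw [ofPred_relabel_ne_free (by simp [hr]) (by simp) (by simp), Finset.coe_singleton] at hsep
  have hcov : ∀ u, Covered (relabel τ r {p} .half .half) M u →
      Covered τ (insert s(r, p) M) u := by
    rintro u (hu | ⟨e, he, hu⟩)
    · by_cases hur : u ∈ s(r, p)
      · exact Or.inr ⟨_, Set.mem_insert _ _, hur⟩
      · left
        simp only [Sym2.mem_iff] at hur
        simp only [relabel, Finset.mem_singleton] at hu
        grind
    · exact Or.inr ⟨e, Set.mem_insert_of_mem _ he, hu⟩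
  have hnot : ∀ v ∈ s(r, p), ∀ e ∈ M, v ∉ e := by
    intro v hv
    simp only [Sym2.mem_iff] at hv
    rcases hv with rfl | rfl
    · exact h.avoid_half _ hrh
    · exact h.avoid_half _ hph
  refine ⟨?_, sup_sdiff_starOn (by simp [hr]) hsep,
    fun hmem => hnot r (by simp) _ hmem (by simp)⟩
  constructor
  · refine hsep.sup_starOn (by simp [hr]) ?_
    simp [hp]
  · intro e he
    rcases Set.mem_insert_iff.1 he with rfl | he
    · exact Or.inr ⟨hrp, Or.inl ⟨rfl, rfl⟩⟩
    · exact SimpleGraph.edgeSet_mono le_sup_left (h.sub he)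
  · intro e he f hf v hve hvf
    rcases Set.mem_insert_iff.1 he with rfl | he <;> rcases Set.mem_insert_iff.1 hf with rfl | hf
    · rfl
    · exact (hnot v hve f hf hvf).elim
    · exact (hnot v hvf e he hve).elim
    · exact h.disj e he f hf v hve hvf
  · rintro v w hv (hadj | ⟨-, ⟨rfl, -⟩ | ⟨rfl, rfl⟩⟩)
    · refine h.isolated v w ?_ hadj
      simp only [relabel, Finset.mem_singleton]
      grind
    · simp [hr] at hv
    · simp [hp] at hv
  · intro v hv e he hve
    rcases Set.mem_insert_iff.1 he with rfl | he
    · simp only [Sym2.mem_iff] at hve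
      grind
    · refine h.avoid_unmatched v ?_ e he hve
      simp only [relabel, Finset.mem_singleton]
      grind
  · intro v hv e he hve
    rcases Set.mem_insert_iff.1 he with rfl | he
    · simp only [Sym2.mem_iff] at hve
      grind
    · refine h.avoid_half v ?_ e he hve
      simp only [relabel, Finset.mem_singleton]
      grind
  · intro v hv
    by_cases hvr : v = r
    · exact ⟨_, Set.mem_insert _ _, by simp [hvr]⟩
    · obtain ⟨e, he, hve⟩ := h.meets_matched v (by simp only [relabel, Finset.mem_singleton]; grind)
      exact ⟨e, Set.mem_insert_of_mem _ he, hve⟩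
  · rintro u v (hadj | ⟨-, ⟨rfl, rfl⟩ | ⟨rfl, rfl⟩⟩)
    · exact (h.cover u v hadj).imp (hcov u) (hcov v)
    · exact Or.inl (Or.inr ⟨_, Set.mem_insert _ _, by simp⟩)
    · exact Or.inr (Or.inr ⟨_, Set.mem_insert _ _, by simp⟩)

end Matched

section Choice

variable {τ : α → VertexState} {F : SimpleGraph α} {M : Set (Sym2 α)} {r : α}

lemma config_of_no_root (h0 : ∀ v, τ v = free ∨ τ v = dead) (hr : τ r = free) :
    Config τ F M ↔ Config (relabel τ r ∅ .unmatched .free) F M ∨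
      Config (relabel τ r ∅ .matched .free) F M := by
  have hroots : ∀ a, a = VertexState.unmatched ∨ a = VertexState.matched →
      (SeparatedForest F {v | τ v ≠ free} ∧ (∀ v w, τ v = dead → ¬ F.Adj v w) ↔
        SeparatedForest F {v | relabel τ r ∅ a .free v ≠ free} ∧
          (∀ v w, relabel τ r ∅ a .free v = dead → ¬ F.Adj v w)) := by
    intro a ha
    have hd : ∀ v, relabel τ r ∅ a .free v = dead ↔ τ v = dead := by
      intro v
      simp only [relabel, Finset.notMem_empty]
      grind
    simp only [hd]
    refine and_congr_left fun hdead => ?_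
    refine ⟨fun h => ⟨h.1, ?_⟩, fun h => ⟨h.1, fun u hu v hv => h.2 u ?_ v ?_⟩⟩
    · have hiso : ∀ u v, τ u = dead → u ≠ v → ¬ F.Reachable u v := by
        intro u v hu huv hreach
        have := mem_of_reachable_of_closed (K := {u})
          (fun a b ha hab => (hdead a b (by rw [ha, hu]) hab).elim) rfl hreach
        exact huv this.symm
      intro u hu v hv huv hreach
      simp only [relabel, Finset.notMem_empty, Set.mem_ofPred_eq] at hu hv
      by_cases hur : u = r
      · exact hiso v u (by grind) huv.symm hreach.symm
      · exact hiso u v (by grind) huv hreach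
    · simp only [relabel, Finset.notMem_empty, Set.mem_ofPred_eq] at hu ⊢
      grind
    · simp only [relabel, Finset.notMem_empty, Set.mem_ofPred_eq] at hv ⊢
      grind
  have hlab : ∀ v, τ v ≠ .unmatched ∧ τ v ≠ .half ∧ τ v ≠ .matched := by
    intro v
    rcases h0 v with h | h <;> simp [h]
  have hcov : ∀ a, a = VertexState.unmatched ∨ a = VertexState.matched → ∀ u,
      (Covered τ M u ↔ Covered (relabel τ r ∅ a .free) M u) := by
    intro a ha u
    refine or_congr_left ?_
    have := hlab u
    simp only [relabel, Finset.notMem_empty]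
    grind
  constructor
  · intro h
    by_cases hM : ∃ e ∈ M, r ∈ e
    · right
      obtain ⟨h1, h2⟩ := (hroots .matched (by simp)).1 ⟨h.sep, h.isolated⟩
      refine ⟨h1, h.sub, h.disj, h2, ?_, ?_, ?_, ?_⟩
      · intro v hv
        have := hlab v
        simp only [relabel, Finset.notMem_empty] at hv
        grind
      · intro v hv
        have := hlab v
        simp only [relabel, Finset.notMem_empty] at hv
        grind
      · intro v hv
        have := hlab v
        have : v = r := by
          simp only [relabel, Finset.notMem_empty] at hv
          grind
        exact this ▸ hM
      · intro u v huv
        exact (h.cover u v huv).imp (hcov _ (by simp) u).1 (hcov _ (by simp) v).1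
    · left
      obtain ⟨h1, h2⟩ := (hroots .unmatched (by simp)).1 ⟨h.sep, h.isolated⟩
      refine ⟨h1, h.sub, h.disj, h2, ?_, ?_, ?_, ?_⟩
      · intro v hv e he hve
        have := hlab v
        have : v = r := by
          simp only [relabel, Finset.notMem_empty] at hv
          grind
        exact hM ⟨e, he, this ▸ hve⟩
      · intro v hv
        have := hlab v
        simp only [relabel, Finset.notMem_empty] at hv
        grind
      · intro v hv
        have := hlab v
        simp only [relabel, Finset.notMem_empty] at hv
        grind
      · intro u v huv
        exact (h.cover u v huv).imp (hcov _ (by simp) u).1 (hcov _ (by simp) v).1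
  · have key : ∀ a, a = VertexState.unmatched ∨ a = VertexState.matched →
        Config (relabel τ r ∅ a .free) F M → Config τ F M := by
      intro a ha h
      obtain ⟨h1, h2⟩ := (hroots a ha).2 ⟨h.sep, h.isolated⟩
      exact ⟨h1, h.sub, h.disj, h2, fun v hv => ((hlab v).1 hv).elim,
        fun v hv => ((hlab v).2.1 hv).elim, fun v hv => ((hlab v).2.2 hv).elim,
        fun u v huv => (h.cover u v huv).imp (hcov a ha u).2 (hcov a ha v).2⟩
    rintro (h | h)
    · exact key _ (by simp) h
    · exact key _ (by simp) h

end Choice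

end Configurations

/-! ### Weighted enumeration of configurations -/

section Enumeration

open VertexState

variable {α : Type*} [Fintype α]

/-- All configurations with vertex states `τ`. -/
noncomputable def configs (τ : α → VertexState) : Finset (SimpleGraph α × Set (Sym2 α)) :=
  (Set.toFinite {p : SimpleGraph α × Set (Sym2 α) | Config τ p.1 p.2}).toFinset

@[simp]
lemma mem_configs {τ : α → VertexState} {p : SimpleGraph α × Set (Sym2 α)} :
    p ∈ configs τ ↔ Config τ p.1 p.2 := by
  simp [configs]

/-- The generating polynomial of the configurations with vertex states `τ`, by matching size. -/
noncomputable def weight (τ : α → VertexState) (x : ℂ) : ℂ :=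
  ∑ p ∈ configs τ, x ^ p.2.ncard

lemma weight_dead {τ : α → VertexState} (h : ∀ v, τ v = dead) (x : ℂ) : weight τ x = 1 := by
  have : configs τ = {(⊥, ∅)} := by
    ext ⟨F, M⟩
    simp only [mem_configs, Finset.mem_singleton, Prod.mk.injEq]
    constructor
    · intro hc
      have hF : F = ⊥ := by
        ext u v
        simpa using hc.isolated u v (h _)
      subst hF
      refine ⟨rfl, ?_⟩
      have := hc.sub
      simpa using this
    · rintro ⟨rfl, rfl⟩
      refine ⟨⟨by simp, ?_⟩, by simp, by simp, by simp, by simp, by simp, ?_, by simp⟩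
      · intro u _ v _ huv
        simpa using huv
      · intro v hv
        simp [h] at hv
  simp [weight, this]

variable [DecidableEq α] {τ : α → VertexState} {r : α}

lemma weight_of_unmatched (hr : τ r = unmatched) (x : ℂ) :
    weight τ x = ∑ J ∈ (Finset.univ.filter (τ · = free)).powerset,
      weight (relabel τ r J dead matched) x := by
  unfold weight
  rw [Finset.sum_sigma']
  symm
  have hfree : ∀ J ∈ (Finset.univ.filter (τ · = free)).powerset, ∀ j ∈ J, τ j = free :=
    fun J hJ j hj => by simpa using Finset.mem_powerset.1 hJ hj
  refine Finset.sum_bij (fun q _ => (q.2.1 ⊔ starOn r q.1, q.2.2)) ?_ ?_ ?_ ?_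
  · rintro ⟨J, F, M⟩ h
    simp only [Finset.mem_sigma, mem_configs] at h
    simpa using (Config.unexplore_unmatched hr (hfree J h.1) h.2).1
  · rintro ⟨J, F, M⟩ h ⟨J', F', M'⟩ h' heq
    simp only [Finset.mem_sigma, mem_configs] at h h'
    simp only [Prod.mk.injEq] at heq
    obtain ⟨-, hJ, hF⟩ := Config.unexplore_unmatched hr (hfree J h.1) h.2
    obtain ⟨-, hJ', hF'⟩ := Config.unexplore_unmatched hr (hfree J' h'.1) h'.2
    have hJJ : J = J' := by
      ext v
      rw [hJ, hJ', heq.1]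
    subst hJJ
    rw [heq.1, hF'] at hF
    rw [hF, heq.2]
  · rintro ⟨F, M⟩ h
    rw [mem_configs] at h
    classical
    set J : Finset α := Finset.univ.filter (F.Adj r ·) with hJdef
    have hJ : ∀ v, v ∈ J ↔ F.Adj r v := by simp [hJdef]
    refine ⟨⟨J, F \ starOn r J, M⟩, ?_, ?_⟩
    · simp only [Finset.mem_sigma, mem_configs, Finset.mem_powerset]
      refine ⟨fun v hv => ?_, h.explore_unmatched hr hJ⟩
      simpa using h.free_of_adj (by simp [hr]) ((hJ v).1 hv)
    · simp only [Prod.mk.injEq, and_true]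
      exact sdiff_sup_cancel (starOn_le fun j hj => (hJ j).1 hj)
  · simp

lemma weight_of_half (hr : τ r = half) (x : ℂ) :
    weight τ x = ∑ J ∈ (Finset.univ.filter (τ · = free)).powerset,
      weight (relabel τ r J unmatched unmatched) x := by
  unfold weight
  rw [Finset.sum_sigma']
  symm
  have hfree : ∀ J ∈ (Finset.univ.filter (τ · = free)).powerset, ∀ j ∈ J, τ j = free :=
    fun J hJ j hj => by simpa using Finset.mem_powerset.1 hJ hj
  refine Finset.sum_bij (fun q _ => (q.2.1 ⊔ starOn r q.1, q.2.2)) ?_ ?_ ?_ ?_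
  · rintro ⟨J, F, M⟩ h
    simp only [Finset.mem_sigma, mem_configs] at h
    simpa using (Config.unexplore_half hr (hfree J h.1) h.2).1
  · rintro ⟨J, F, M⟩ h ⟨J', F', M'⟩ h' heq
    simp only [Finset.mem_sigma, mem_configs] at h h'
    simp only [Prod.mk.injEq] at heq
    obtain ⟨-, hJ, hF⟩ := Config.unexplore_half hr (hfree J h.1) h.2
    obtain ⟨-, hJ', hF'⟩ := Config.unexplore_half hr (hfree J' h'.1) h'.2
    have hJJ : J = J' := by
      ext v
      rw [hJ, hJ', heq.1, heq.2]
    subst hJJ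
    rw [heq.1, hF'] at hF
    rw [hF, heq.2]
  · rintro ⟨F, M⟩ h
    rw [mem_configs] at h
    classical
    set J : Finset α := Finset.univ.filter (fun v => F.Adj r v ∧ ∀ e ∈ M, v ∉ e) with hJdef
    have hJ : ∀ v, v ∈ J ↔ F.Adj r v ∧ ∀ e ∈ M, v ∉ e := by simp [hJdef]
    refine ⟨⟨J, F \ starOn r J, M⟩, ?_, ?_⟩
    · simp only [Finset.mem_sigma, mem_configs, Finset.mem_powerset]
      refine ⟨fun v hv => ?_, h.explore_half hr hJ⟩
      simpa using h.free_of_adj (by simp [hr]) ((hJ v).1 hv).1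
    · simp only [Prod.mk.injEq, and_true]
      exact sdiff_sup_cancel (starOn_le fun j hj => ((hJ j).1 hj).1)
  · simp

lemma weight_of_matched (hr : τ r = matched) (x : ℂ) :
    weight τ x = x * ∑ p ∈ Finset.univ.filter (τ · = free),
      weight (relabel τ r {p} half half) x := by
  unfold weight
  rw [Finset.sum_sigma', Finset.mul_sum]
  symm
  refine Finset.sum_bij (fun q _ => (q.2.1 ⊔ starOn r {q.1}, insert s(r, q.1) q.2.2)) ?_ ?_ ?_ ?_
  · rintro ⟨p, F, M⟩ h
    simp only [Finset.mem_sigma, mem_configs, Finset.mem_filter_univ] at h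
    simpa using (Config.unexplore_matched hr h.1 h.2).1
  · rintro ⟨p, F, M⟩ h ⟨p', F', M'⟩ h' heq
    simp only [Finset.mem_sigma, mem_configs, Finset.mem_filter_univ] at h h'
    simp only [Prod.mk.injEq] at heq
    obtain ⟨hc, hF, hM⟩ := Config.unexplore_matched hr h.1 h.2
    obtain ⟨-, hF', hM'⟩ := Config.unexplore_matched hr h'.1 h'.2
    have hpp : p = p' := by
      have := hc.disj s(r, p) (by simp) s(r, p') (by rw [heq.2]; simp) r (by simp) (by simp)
      rcases by simpa using this with h1 | ⟨h1, h2⟩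
      · exact h1
      · exact h2.trans h1
    subst hpp
    rw [heq.1, hF'] at hF
    have hMM : M = M' := by
      rw [← Set.insert_sdiff_self_of_notMem hM, heq.2, Set.insert_sdiff_self_of_notMem hM']
    rw [hF, hMM]
  · rintro ⟨F, M⟩ h
    rw [mem_configs] at h
    obtain ⟨e, he, hre⟩ := h.meets_matched r hr
    obtain ⟨p, rfl⟩ := Sym2.mem_iff_exists.1 hre
    have hadj : F.Adj r p := h.sub he
    refine ⟨⟨p, F \ starOn r {p}, M \ {s(r, p)}⟩, ?_, ?_⟩
    · simp only [Finset.mem_sigma, mem_configs, Finset.mem_filter_univ]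
      exact ⟨h.free_of_adj (by simp [hr]) hadj, h.explore_matched hr he⟩
    · simp only [Prod.mk.injEq]
      refine ⟨sdiff_sup_cancel (starOn_le fun j hj => by simpa [Set.mem_singleton_iff.1 hj]), ?_⟩
      simpa using he
  · rintro ⟨p, F, M⟩ h
    simp only [Finset.mem_sigma, mem_configs, Finset.mem_filter_univ] at h
    obtain ⟨-, -, hM⟩ := Config.unexplore_matched hr h.1 h.2
    rw [Set.ncard_insert_of_notMem hM (Set.toFinite _), pow_succ']

lemma weight_of_no_root (h0 : ∀ v, τ v = free ∨ τ v = dead) (hr : τ r = free) (x : ℂ) :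
    weight τ x = weight (relabel τ r ∅ unmatched free) x +
      weight (relabel τ r ∅ matched free) x := by
  classical
  unfold weight
  rw [← Finset.sum_union]
  · congr 1
    ext p
    simp [config_of_no_root h0 hr]
  · rw [Finset.disjoint_left]
    intro p h h'
    rw [mem_configs] at h h'
    obtain ⟨e, he, hre⟩ := h'.meets_matched r (by simp [relabel])
    exact h.avoid_unmatched r (by simp [relabel]) e he hre

end Enumeration

section Counting

open VertexState

variable {α : Type*} [Fintype α]

/-- The number of vertices in state `s`. -/
def stateCount (τ : α → VertexState) (s : VertexState) : ℕ :=
  (Finset.univ.filter (τ · = s)).card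

lemma stateCount_relabel [DecidableEq α] {τ : α → VertexState} {r : α} {J : Finset α}
    {a b : VertexState} (hJ : ∀ j ∈ J, τ j = free) (hr : r ∉ J) (s : VertexState) :
    stateCount (relabel τ r J a b) s + (if τ r = s then 1 else 0) +
        (if free = s then J.card else 0) =
      stateCount τ s + (if a = s then 1 else 0) + (if b = s then J.card else 0) := by
  have hone : ∀ P : Prop, ∀ [Decidable P], (if P then 1 else 0 : ℕ) =
      ∑ v : α, if v = r then (if P then 1 else 0) else 0 := by
    intro P _
    simp
  have hcard : ∀ P : Prop, ∀ [Decidable P], (if P then J.card else 0 : ℕ) =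
      ∑ v : α, if v ∈ J then (if P then 1 else 0) else 0 := by
    intro P _
    split_ifs <;> simp
  simp only [stateCount, Finset.card_filter]
  rw [hone (τ r = s), hone (a = s), hcard (free = s), hcard (b = s)]
  simp only [← Finset.sum_add_distrib]
  refine Finset.sum_congr rfl fun v _ => ?_
  have := hJ v
  unfold relabel
  by_cases h1 : v = r
  · subst h1
    simp [hr]
    omega
  · by_cases h2 : v ∈ J
    · simp [h1, h2, this h2]
      omega
    · simp [h1, h2]

lemma exists_of_stateCount_pos {τ : α → VertexState} {s : VertexState}
    (h : stateCount τ s ≠ 0) : ∃ r, τ r = s := by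
  obtain ⟨r, hr⟩ := Finset.card_ne_zero.1 h
  exact ⟨r, by simpa using hr⟩

lemma ne_of_stateCount_eq_zero {τ : α → VertexState} {s : VertexState}
    (h : stateCount τ s = 0) (v : α) : τ v ≠ s := by
  intro hv
  have := Finset.card_eq_zero.1 h
  have hm : v ∈ Finset.univ.filter (τ · = s) := by simpa using hv
  simp [this] at hm

lemma sum_choose_stateCount (τ : α → VertexState) (f : ℕ → ℂ) :
    ∑ j ∈ Finset.range (stateCount τ free + 1), ((stateCount τ free).choose j : ℂ) * f j =
      ∑ J ∈ (Finset.univ.filter (τ · = free)).powerset, f J.card := by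
  rw [Finset.sum_powerset_apply_card]
  simp only [nsmul_eq_mul, stateCount]

/-- The exploration recursion determines the weight from the number of vertices in each state. -/
lemma weight_eq_of_recursion [DecidableEq α] {x : ℂ} {Φ : ℕ → ℕ → ℕ → ℕ → ℂ} (h0 : Φ 0 0 0 0 = 1)
    (hU : ∀ n a b c, Φ n (a + 1) b c =
      ∑ j ∈ Finset.range (n + 1), (n.choose j : ℂ) * Φ (n - j) a (b + j) c)
    (hH : ∀ n a b c, Φ n a b (c + 1) =
      ∑ j ∈ Finset.range (n + 1), (n.choose j : ℂ) * Φ (n - j) (a + 1 + j) b c)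
    (hM : ∀ n a b c, Φ n a (b + 1) c = x * (n * Φ (n - 1) a b (c + 2)))
    (hC : ∀ n, Φ (n + 1) 0 0 0 = Φ n 1 0 0 + Φ n 0 1 0) (τ : α → VertexState) :
    weight τ x = Φ (stateCount τ free) (stateCount τ unmatched) (stateCount τ matched)
      (stateCount τ half) := by
  induction hN : 4 * stateCount τ free + 3 * stateCount τ matched + 2 * stateCount τ half +
    stateCount τ unmatched using Nat.strong_induction_on generalizing τ with
  | _ N ih =>
  have hfree : ∀ J ∈ (Finset.univ.filter (τ · = free)).powerset, ∀ j ∈ J, τ j = free :=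
    fun J hJ j hj => by simpa using Finset.mem_powerset.1 hJ hj
  have hnot : ∀ r, τ r ≠ free → ∀ J ∈ (Finset.univ.filter (τ · = free)).powerset, r ∉ J :=
    fun r hr J hJ hj => hr (hfree J hJ r hj)
  have hle : ∀ J ∈ (Finset.univ.filter (τ · = free)).powerset, J.card ≤ stateCount τ free :=
    fun J hJ => Finset.card_le_card (Finset.mem_powerset.1 hJ)
  by_cases hu : stateCount τ unmatched = 0
  swap
  · obtain ⟨r, hr⟩ := exists_of_stateCount_pos hu
    obtain ⟨a, ha⟩ := Nat.exists_eq_succ_of_ne_zero hu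
    rw [weight_of_unmatched hr, ha, Nat.succ_eq_add_one, hU]
    rw [sum_choose_stateCount τ fun j => Φ (stateCount τ free - j) a
      (stateCount τ matched + j) (stateCount τ half)]
    refine Finset.sum_congr rfl fun J hJ => ?_
    have hs := stateCount_relabel (a := dead) (b := matched) (hfree J hJ)
      (hnot r (by simp [hr]) J hJ)
    have h1 := hs free
    have h2 := hs unmatched
    have h3 := hs matched
    have h4 := hs half
    simp only [hr, reduceCtorEq, if_false, if_true] at h1 h2 h3 h4
    have := hle J hJ
    rw [ih _ (by omega) _ rfl]
    congr 1 <;> omega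
  by_cases hh : stateCount τ half = 0
  swap
  · obtain ⟨r, hr⟩ := exists_of_stateCount_pos hh
    obtain ⟨c, hc⟩ := Nat.exists_eq_succ_of_ne_zero hh
    rw [weight_of_half hr, hc, Nat.succ_eq_add_one, hH]
    rw [sum_choose_stateCount τ fun j => Φ (stateCount τ free - j)
      (stateCount τ unmatched + 1 + j) (stateCount τ matched) c]
    refine Finset.sum_congr rfl fun J hJ => ?_
    have hs := stateCount_relabel (a := unmatched) (b := unmatched) (hfree J hJ)
      (hnot r (by simp [hr]) J hJ)
    have h1 := hs free
    have h2 := hs unmatched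
    have h3 := hs matched
    have h4 := hs half
    simp only [hr, reduceCtorEq, if_false, if_true] at h1 h2 h3 h4
    have := hle J hJ
    rw [ih _ (by omega) _ rfl]
    congr 1 <;> omega
  by_cases hm : stateCount τ matched = 0
  swap
  · obtain ⟨r, hr⟩ := exists_of_stateCount_pos hm
    obtain ⟨b, hb⟩ := Nat.exists_eq_succ_of_ne_zero hm
    rw [weight_of_matched hr, hb, Nat.succ_eq_add_one, hM, stateCount, ← nsmul_eq_mul,
      ← Finset.sum_const]
    congr 1
    refine Finset.sum_congr rfl fun p hp => ?_
    have hp : τ p = free := by simpa using hp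
    have hs := stateCount_relabel (τ := τ) (r := r) (J := {p}) (a := half) (b := half)
      (by simpa using hp) (by
        rw [Finset.mem_singleton]
        rintro rfl
        simp [hr] at hp)
    have h1 := hs free
    have h2 := hs unmatched
    have h3 := hs matched
    have h4 := hs half
    simp only [hr, reduceCtorEq, if_false, if_true, Finset.card_singleton] at h1 h2 h3 h4
    rw [ih _ (by omega) _ rfl]
    change _ = Φ (stateCount τ free - 1) _ _ _
    congr 1 <;> omega
  have h0' : ∀ v, τ v = free ∨ τ v = dead := by
    intro v
    have h1 := ne_of_stateCount_eq_zero hu v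
    have h2 := ne_of_stateCount_eq_zero hh v
    have h3 := ne_of_stateCount_eq_zero hm v
    cases hv : τ v
    · exact Or.inl rfl
    · exact absurd hv h1
    · exact absurd hv h3
    · exact absurd hv h2
    · exact Or.inr rfl
  by_cases hf : stateCount τ free = 0
  · rw [weight_dead, hf, hu, hh, hm, h0]
    exact fun v => (h0' v).resolve_left (ne_of_stateCount_eq_zero hf v)
  obtain ⟨r, hr⟩ := exists_of_stateCount_pos hf
  obtain ⟨n, hn⟩ := Nat.exists_eq_succ_of_ne_zero hf
  have key : ∀ a, stateCount (relabel τ r ∅ a free) free + 1 = n + 1 + (if a = free then 1 else 0) ∧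
      ∀ s, s ≠ free → stateCount (relabel τ r ∅ a free) s =
        stateCount τ s + if a = s then 1 else 0 := by
    intro a
    have hs := stateCount_relabel (τ := τ) (r := r) (J := ∅) (a := a) (b := free)
      (by simp) (by simp)
    refine ⟨by simpa [hr, hn] using hs free, fun s hs' => ?_⟩
    simpa [hr, hs'.symm] using hs s
  obtain ⟨u1, u2⟩ := key unmatched
  obtain ⟨m1, m2⟩ := key matched
  have e1 := u2 unmatched (by simp)
  have e2 := u2 matched (by simp)
  have e3 := u2 half (by simp)
  have f1 := m2 unmatched (by simp)
  have f2 := m2 matched (by simp)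
  have f3 := m2 half (by simp)
  simp only [reduceCtorEq, if_false, if_true] at u1 m1 e1 e2 e3 f1 f2 f3
  rw [weight_of_no_root h0' hr, hn, hu, hh, hm, Nat.succ_eq_add_one, hC, ih _ (by omega) _ rfl,
    ih _ (by omega) _ rfl]
  congr 2 <;> omega

end Counting

instance (n : ℕ) : Finite (MMSpace n) := Subtype.finite

/-- The generating polynomial of `MMSpace n` is the weight of the unexplored configuration. -/
lemma weight_free_eq (n : ℕ) (x : ℂ) [Fintype (MMSpace n)] :
    weight (fun _ : Fin n => VertexState.free) x = ∑ p : MMSpace n, x ^ p.val.2.ncard := by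
  refine Finset.sum_bij' (fun p hp => ⟨p, config_free_iff.1 (mem_configs.1 hp)⟩)
    (fun p _ => p.val) ?_ ?_ ?_ ?_ ?_
  · exact fun p _ => Finset.mem_univ _
  · intro p _
    exact mem_configs.2 (config_free_iff.2 p.property)
  · exact fun p _ => rfl
  · exact fun p _ => rfl
  · exact fun p _ => rfl

/-! ### Taylor coefficients as contour integrals -/

section ContourIntegral

/-- The `n`-th Laurent coefficient of `f` along the circle of radius `ρ`. -/
noncomputable def circleCoeff (ρ : ℝ) (n : ℕ) (f : ℂ → ℂ) : ℂ :=
  (2 * Real.pi * Complex.I)⁻¹ * ∮ s in C(0, ρ), f s / s ^ (n + 1)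

variable {ρ : ℝ} {n : ℕ} {f g : ℂ → ℂ}

lemma circleCoeff_congr (hρ : 0 < ρ) (h : ∀ s ∈ Metric.sphere (0 : ℂ) ρ, f s = g s) :
    circleCoeff ρ n f = circleCoeff ρ n g := by
  unfold circleCoeff
  congr 1
  refine circleIntegral.integral_congr hρ.le fun s hs => ?_
  simp only [h s hs]

lemma circleIntegrable_div_pow (hρ : 0 < ρ) (n : ℕ) (hf : ContinuousOn f (Metric.sphere 0 ρ)) :
    CircleIntegrable (fun s => f s / s ^ (n + 1)) 0 ρ := by
  refine ContinuousOn.circleIntegrable hρ.le (hf.div (by fun_prop) fun s hs => ?_)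
  exact pow_ne_zero _ (ne_zero_of_mem_sphere hρ.ne' ⟨s, hs⟩)

lemma circleCoeff_add (hρ : 0 < ρ) (hf : ContinuousOn f (Metric.sphere 0 ρ))
    (hg : ContinuousOn g (Metric.sphere 0 ρ)) :
    circleCoeff ρ n (fun s => f s + g s) = circleCoeff ρ n f + circleCoeff ρ n g := by
  simp only [circleCoeff, add_div]
  rw [circleIntegral.integral_add (circleIntegrable_div_pow hρ n hf)
    (circleIntegrable_div_pow hρ n hg), mul_add]

lemma circleCoeff_const_mul (c : ℂ) (f : ℂ → ℂ) :
    circleCoeff ρ n (fun s => c * f s) = c * circleCoeff ρ n f := by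
  simp only [circleCoeff, mul_div_assoc]
  rw [circleIntegral.integral_const_mul]
  ring

/-- Integration by parts: the coefficients of `s * W'(s)` are `n` times those of `W`. -/
lemma circleCoeff_mul_deriv (hρ : 0 < ρ) {W W' : ℂ → ℂ}
    (hW : ∀ s ∈ Metric.sphere (0 : ℂ) ρ, HasDerivAt W (W' s) s)
    (hW' : ContinuousOn W' (Metric.sphere 0 ρ)) :
    circleCoeff ρ n (fun s => s * W' s) = n * circleCoeff ρ n W := by
  have hWc : ContinuousOn W (Metric.sphere 0 ρ) :=
    fun s hs => (hW s hs).continuousAt.continuousWithinAt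
  have h0 : (∮ s in C(0, ρ), (s * W' s + (-n : ℂ) * W s) / s ^ (n + 1)) = 0 := by
    refine circleIntegral.integral_eq_zero_of_hasDerivWithinAt hρ.le
      (f := fun s => W s / s ^ n) fun s hs => ?_
    have hs0 : s ≠ 0 := ne_zero_of_mem_sphere hρ.ne' ⟨s, hs⟩
    have := ((hW s hs).div (hasDerivAt_pow n s) (pow_ne_zero n hs0)).hasDerivWithinAt
      (s := Metric.sphere (0 : ℂ) ρ)
    refine this.congr_deriv ?_
    rcases n with _ | m
    · simp
      field_simp
    · simp only [Nat.add_sub_cancel]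
      field_simp
      push_cast
      ring
  have h1 : circleCoeff ρ n (fun s => s * W' s + (-n : ℂ) * W s) = 0 := by
    rw [circleCoeff, h0, mul_zero]
  rw [circleCoeff_add (f := fun s => s * W' s) (g := fun s => (-n : ℂ) * W s) hρ
    (continuousOn_id.mul hW') (continuousOn_const.mul hWc),
    circleCoeff_const_mul] at h1
  linear_combination h1

lemma circleCoeff_pow_mul_of_le (hρ : 0 < ρ) {j : ℕ} (hj : j ≤ n) (f : ℂ → ℂ) :
    circleCoeff ρ n (fun s => s ^ j * f s) = circleCoeff ρ (n - j) f := by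
  unfold circleCoeff
  congr 1
  refine circleIntegral.integral_congr hρ.le fun s hs => ?_
  have hs0 : s ≠ 0 := ne_zero_of_mem_sphere hρ.ne' ⟨s, hs⟩
  simp only
  rw [show n + 1 = j + (n - j + 1) by omega, pow_add]
  field_simp

lemma circleCoeff_pow_mul_of_lt (hρ : 0 < ρ) {j : ℕ} (hj : n < j) (hf : Differentiable ℂ f) :
    circleCoeff ρ n (fun s => s ^ j * f s) = 0 := by
  have : (∮ s in C(0, ρ), s ^ j * f s / s ^ (n + 1)) =
      ∮ s in C(0, ρ), s ^ (j - (n + 1)) * f s := by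
    refine circleIntegral.integral_congr hρ.le fun s hs => ?_
    have hs0 : s ≠ 0 := ne_zero_of_mem_sphere hρ.ne' ⟨s, hs⟩
    rw [show s ^ j = s ^ (n + 1) * s ^ (j - (n + 1)) by rw [← pow_add]; congr 1; omega]
    field_simp
  rw [circleCoeff, this, Complex.circleIntegral_eq_zero_of_differentiable_on_off_countable hρ.le
    Set.countable_empty (Differentiable.continuous (𝕜 := ℂ) (by fun_prop)).continuousOn
    (fun z _ => by fun_prop), mul_zero]

lemma circleCoeff_zero (hρ : 0 < ρ) (hf : Differentiable ℂ f) : circleCoeff ρ 0 f = f 0 := by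
  have := hf.diffContOnCl.circleIntegral_sub_inv_smul (c := 0) (R := ρ) (w := 0) (by simpa using hρ)
  simp only [sub_zero, smul_eq_mul] at this
  have h2 : (∮ s in C(0, ρ), f s / s ^ (0 + 1)) = ∮ s in C(0, ρ), s⁻¹ * f s := by
    congr 1
    ext s
    simp [div_eq_inv_mul]
  rw [circleCoeff, h2, this, ← mul_assoc, inv_mul_cancel₀ Complex.two_pi_I_ne_zero, one_mul]

/-- Expansion of an exponential factor. -/
lemma circleCoeff_mul_exp (hρ : 0 < ρ) {ψ : ℂ → ℂ} (hf : Differentiable ℂ f)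
    (hψ : Differentiable ℂ ψ) :
    circleCoeff ρ n (fun s => f s * Complex.exp (s * ψ s)) =
      ∑ j ∈ Finset.range (n + 1), (j.factorial : ℂ)⁻¹ *
        circleCoeff ρ (n - j) (fun s => f s * ψ s ^ j) := by
  set F : ℕ → ℂ → ℂ := fun j s => (j.factorial : ℂ)⁻¹ * (s ^ j * (f s * ψ s ^ j)) with hF
  have hFd : ∀ j, Differentiable ℂ (F j) := fun j => by fun_prop
  have hterm : ∀ j, circleCoeff ρ n (F j) =
      if j < n + 1 then (j.factorial : ℂ)⁻¹ * circleCoeff ρ (n - j) (fun s => f s * ψ s ^ j)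
      else 0 := by
    intro j
    rw [hF, circleCoeff_const_mul]
    split_ifs with h
    · rw [circleCoeff_pow_mul_of_le hρ (by omega)]
    · rw [circleCoeff_pow_mul_of_lt hρ (by omega) (by fun_prop), mul_zero]
  have hmem : ∀ θ, circleMap (0 : ℂ) ρ θ ∈ Metric.sphere (0 : ℂ) ρ :=
    circleMap_mem_sphere 0 hρ.le
  obtain ⟨A, hA⟩ := (isCompact_sphere (0 : ℂ) ρ).exists_bound_of_continuousOn
    (f := fun s => s * ψ s) (continuousOn_id.mul hψ.continuous.continuousOn)
  obtain ⟨B, hB⟩ := (isCompact_sphere (0 : ℂ) ρ).exists_bound_of_continuousOn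
    (f := fun s => s * (f s / s ^ (n + 1)))
    (continuousOn_id.mul (hf.continuous.continuousOn.div (by fun_prop)
      fun s hs => pow_ne_zero _ (ne_zero_of_mem_sphere hρ.ne' ⟨s, hs⟩)))
  have hsum : HasSum (fun j => ∮ s in C(0, ρ), F j s / s ^ (n + 1))
      (∮ s in C(0, ρ), f s * Complex.exp (s * ψ s) / s ^ (n + 1)) := by
    simp only [circleIntegral]
    refine intervalIntegral.hasSum_integral_of_dominated_convergence
      (fun j _ => B * (A ^ j / j.factorial)) ?_ ?_ ?_ ?_ ?_
    · intro j
      have := (circleIntegrable_div_pow hρ n (hFd j).continuous.continuousOn).out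
      exact (intervalIntegrable_iff.1 this).aestronglyMeasurable
    · intro j
      refine Eventually.of_forall fun θ _ => ?_
      have h1 := hA _ (hmem θ)
      have h2 := hB _ (hmem θ)
      set s := circleMap (0 : ℂ) ρ θ
      have h3 : deriv (circleMap 0 ρ) θ • (F j s / s ^ (n + 1)) =
          Complex.I * ((s * (f s / s ^ (n + 1))) * ((s * ψ s) ^ j / j.factorial)) := by
        rw [deriv_circleMap, hF]
        simp only [smul_eq_mul, mul_pow]
        change s * Complex.I * _ = _
        ring
      rw [h3, norm_mul, norm_mul, norm_div, norm_pow, Complex.norm_I, one_mul, Complex.norm_natCast]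
      have h0 : 0 ≤ B := (norm_nonneg _).trans h2
      gcongr
    · refine Eventually.of_forall fun θ _ => ?_
      exact (Real.summable_pow_div_factorial A).mul_left B
    · exact intervalIntegrable_const
    · refine Eventually.of_forall fun θ _ => ?_
      set s := circleMap (0 : ℂ) ρ θ
      have := NormedSpace.expSeries_div_hasSum_exp (𝔸 := ℂ) (s * ψ s)
      rw [← Complex.exp_eq_exp_ℂ] at this
      have := (this.mul_left (f s / s ^ (n + 1))).const_smul (deriv (circleMap 0 ρ) θ)
      rw [div_mul_eq_mul_div] at this
      refine this.congr_fun fun j => ?_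
      simp only [hF, mul_pow]
      congr 1
      ring
  have h1 := hsum.mul_left (2 * Real.pi * Complex.I)⁻¹
  have h2 : HasSum (fun j => circleCoeff ρ n (F j))
      (circleCoeff ρ n fun s => f s * Complex.exp (s * ψ s)) := h1
  have h3 : HasSum (fun j => circleCoeff ρ n (F j)) _ := hasSum_sum_of_ne_finset_zero
    (s := Finset.range (n + 1)) (fun j hj => by
      rw [hterm, if_neg (by simpa using hj)])
  rw [h2.unique h3]
  refine Finset.sum_congr rfl fun j hj => ?_
  rw [hterm, if_pos (by simpa using hj)]

end ContourIntegral

section ExplorationWeight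

/-- The function `x s² exp (2 s)` in the exponent of the contour integrals. -/
noncomputable def phase (x s : ℂ) : ℂ := x * s ^ 2 * Complex.exp (2 * s)

/-- The exponent of the amplitude that does not scale with the number of vertices. -/
noncomputable def potential (x s : ℂ) : ℂ :=
  s + phase x s / 2 - phase x s ^ 2 / 2 - s * phase x s

/-- The amplitude after integrating by parts twice. -/
noncomputable def amplitude (x s : ℂ) : ℂ :=
  s + (2 + 2 * s) * phase x s + (phase x s + s) ^ 2 * (1 - (2 + 2 * s) * phase x s)

lemma hasDerivAt_phase (x s : ℂ) :
    HasDerivAt (phase x) ((2 * s + 2 * s ^ 2) * x * Complex.exp (2 * s)) s := by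
  have h1 : HasDerivAt (fun s : ℂ => Complex.exp (2 * s)) (Complex.exp (2 * s) * (2 * 1)) s :=
    ((hasDerivAt_id s).const_mul 2).cexp
  refine (((hasDerivAt_pow 2 s).const_mul x).mul h1).congr_deriv ?_
  push_cast
  ring

@[fun_prop]
lemma differentiable_phase (x : ℂ) : Differentiable ℂ (phase x) :=
  fun s => (hasDerivAt_phase x s).differentiableAt

@[fun_prop]
lemma differentiable_potential (x : ℂ) : Differentiable ℂ (potential x) := by
  unfold potential
  fun_prop

@[fun_prop]
lemma differentiable_amplitude (x : ℂ) : Differentiable ℂ (amplitude x) := by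
  unfold amplitude
  fun_prop

lemma hasDerivAt_potential (x s : ℂ) :
    HasDerivAt (potential x) (1 + (2 * s + 2 * s ^ 2) * x * Complex.exp (2 * s) / 2
      - phase x s * ((2 * s + 2 * s ^ 2) * x * Complex.exp (2 * s))
      - (phase x s + s * ((2 * s + 2 * s ^ 2) * x * Complex.exp (2 * s)))) s := by
  have h := hasDerivAt_phase x s
  have := (((hasDerivAt_id s).add (h.div_const 2)).sub ((h.pow 2).div_const 2)).sub
    ((hasDerivAt_id s).mul h)
  refine this.congr_deriv ?_
  simp only [id]
  push_cast
  ring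

/-- The integrand representing the weight of configurations with given state counts. -/
noncomputable def explorationKernel (x : ℂ) (n a b c : ℕ) (s : ℂ) : ℂ :=
  Complex.exp (potential x s) * (1 - (2 + 2 * s) * phase x s) * Complex.exp ((n + a) * phase x s) *
    (x * s * Complex.exp (2 * s + phase x s)) ^ b * Complex.exp (c * (phase x s + s))

/-- The contour integral representing the weight of configurations with given state counts. -/
noncomputable def explorationWeight (ρ : ℝ) (x : ℂ) (n a b c : ℕ) : ℂ :=
  n.factorial * circleCoeff ρ n (explorationKernel x n a b c)

variable {ρ : ℝ}

lemma differentiable_explorationKernel (x : ℂ) (n a b c : ℕ) :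
    Differentiable ℂ (explorationKernel x n a b c) := by
  unfold explorationKernel
  fun_prop

lemma explorationWeight_zero (hρ : 0 < ρ) (x : ℂ) : explorationWeight ρ x 0 0 0 0 = 1 := by
  rw [explorationWeight, circleCoeff_zero hρ (differentiable_explorationKernel x 0 0 0 0)]
  simp [explorationKernel, potential, phase]

lemma choose_mul_factorial_sub {n j : ℕ} (h : j ≤ n) :
    (n.choose j : ℂ) * (n - j).factorial = n.factorial * (j.factorial : ℂ)⁻¹ := by
  have h2 : (j.factorial : ℂ) ≠ 0 := by exact_mod_cast j.factorial_ne_zero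
  field_simp
  exact_mod_cast (by rw [← Nat.choose_mul_factorial_mul_factorial h]; ring :
    n.choose j * (n - j).factorial * j.factorial = n.factorial)

lemma explorationWeight_unmatched (hρ : 0 < ρ) (x : ℂ) (n a b c : ℕ) :
    explorationWeight ρ x n (a + 1) b c = ∑ j ∈ Finset.range (n + 1),
      (n.choose j : ℂ) * explorationWeight ρ x (n - j) a (b + j) c := by
  have key := circleCoeff_mul_exp (n := n) hρ (differentiable_explorationKernel x n a b c)
    (ψ := fun s => x * s * Complex.exp (2 * s)) (by fun_prop)
  have h1 : explorationKernel x n (a + 1) b c = fun s => explorationKernel x n a b c s *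
      Complex.exp (s * (x * s * Complex.exp (2 * s))) := by
    ext s
    have : s * (x * s * Complex.exp (2 * s)) = phase x s := by
      unfold phase
      ring
    rw [this, explorationKernel, explorationKernel]
    push_cast
    rw [show (n + (a + 1)) * phase x s = (n + a) * phase x s + phase x s by ring, Complex.exp_add]
    ring
  rw [explorationWeight, h1, key, Finset.mul_sum]
  refine Finset.sum_congr rfl fun j hj => ?_
  have hj : j ≤ n := by simpa [Nat.lt_succ_iff] using hj
  rw [explorationWeight, ← mul_assoc, ← mul_assoc, choose_mul_factorial_sub hj]
  congr 2
  ext s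
  rw [explorationKernel, explorationKernel, Nat.cast_sub hj, pow_add, mul_pow (x * s) _ j,
    ← Complex.exp_nat_mul (2 * s) j, mul_pow (x * s) _ j,
    ← Complex.exp_nat_mul (2 * s + phase x s) j]
  have : Complex.exp ((n + a) * phase x s) * Complex.exp (j * (2 * s)) =
      Complex.exp ((n - j + a) * phase x s) * Complex.exp (j * (2 * s + phase x s)) := by
    rw [← Complex.exp_add, ← Complex.exp_add]
    ring_nf
  linear_combination (Complex.exp (potential x s) * (1 - (2 + 2 * s) * phase x s) *
    (x * s * Complex.exp (2 * s + phase x s)) ^ b * Complex.exp (c * (phase x s + s)) *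
      (x * s) ^ j) * this

lemma explorationWeight_half (hρ : 0 < ρ) (x : ℂ) (n a b c : ℕ) :
    explorationWeight ρ x n a b (c + 1) = ∑ j ∈ Finset.range (n + 1),
      (n.choose j : ℂ) * explorationWeight ρ x (n - j) (a + 1 + j) b c := by
  have key := circleCoeff_mul_exp (n := n) hρ (differentiable_explorationKernel x n (a + 1) b c)
    (ψ := fun _ => 1) (by fun_prop)
  have h1 : explorationKernel x n a b (c + 1) = fun s => explorationKernel x n (a + 1) b c s *
      Complex.exp (s * 1) := by
    ext s
    rw [explorationKernel, explorationKernel]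
    have : Complex.exp ((n + a) * phase x s) * Complex.exp ((c + 1) * (phase x s + s)) =
        Complex.exp ((n + (a + 1)) * phase x s) * Complex.exp (c * (phase x s + s)) *
          Complex.exp (s * 1) := by
      rw [← Complex.exp_add, ← Complex.exp_add, ← Complex.exp_add]
      ring_nf
    push_cast
    linear_combination (Complex.exp (potential x s) * (1 - (2 + 2 * s) * phase x s) *
      (x * s * Complex.exp (2 * s + phase x s)) ^ b) * this
  rw [explorationWeight, h1, key, Finset.mul_sum]
  refine Finset.sum_congr rfl fun j hj => ?_
  have hj : j ≤ n := by simpa [Nat.lt_succ_iff] using hj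
  rw [explorationWeight, ← mul_assoc, ← mul_assoc, choose_mul_factorial_sub hj]
  congr 2
  ext s
  rw [explorationKernel, explorationKernel, Nat.cast_sub hj, one_pow, mul_one]
  push_cast
  ring_nf

lemma explorationWeight_matched (hρ : 0 < ρ) (x : ℂ) (n a b c : ℕ) :
    explorationWeight ρ x n a (b + 1) c =
      x * (n * explorationWeight ρ x (n - 1) a b (c + 2)) := by
  have h1 : explorationKernel x n a (b + 1) c = fun s => s ^ 1 *
      (explorationKernel x n a b c s * (x * Complex.exp (2 * s + phase x s))) := by
    ext s
    rw [explorationKernel, explorationKernel, pow_succ]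
    ring
  have hd := differentiable_explorationKernel x n a b c
  rcases n with _ | n
  · rw [explorationWeight, h1, circleCoeff_pow_mul_of_lt hρ (by omega) (by fun_prop)]
    simp
  · rw [explorationWeight, h1, circleCoeff_pow_mul_of_le hρ (by omega), Nat.add_sub_cancel,
      explorationWeight, Nat.factorial_succ]
    have : (fun s => explorationKernel x (n + 1) a b c s * (x * Complex.exp (2 * s + phase x s))) =
        fun s => x * explorationKernel x n a b (c + 2) s := by
      ext s
      rw [explorationKernel, explorationKernel]
      have : Complex.exp (((n + 1 : ℕ) + a) * phase x s) * Complex.exp (c * (phase x s + s)) *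
          Complex.exp (2 * s + phase x s) = Complex.exp ((n + a) * phase x s) *
            Complex.exp ((c + 2 : ℕ) * (phase x s + s)) := by
        rw [← Complex.exp_add, ← Complex.exp_add, ← Complex.exp_add]
        push_cast
        ring_nf
      linear_combination (Complex.exp (potential x s) * (1 - (2 + 2 * s) * phase x s) *
        (x * s * Complex.exp (2 * s + phase x s)) ^ b * x) * this
    rw [this, circleCoeff_const_mul]
    push_cast
    ring

/-- The first integration by parts. -/
lemma circleCoeff_potential (hρ : 0 < ρ) (x : ℂ) (n : ℕ) :
    (n : ℂ) * circleCoeff ρ n (explorationKernel x n 0 0 0) =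
      circleCoeff ρ n (fun s => explorationKernel x n 0 0 0 s * (s + phase x s)) := by
  set W : ℂ → ℂ := fun s => Complex.exp (potential x s) * Complex.exp (n * phase x s) with hW
  have hWd : Differentiable ℂ W := by fun_prop
  have hder : ∀ s, s * deriv W s = explorationKernel x n 0 0 0 s * (s + phase x s) +
      n * (W s - explorationKernel x n 0 0 0 s) := by
    intro s
    have : HasDerivAt W _ s :=
      (hasDerivAt_potential x s).cexp.mul ((hasDerivAt_phase x s).const_mul (n : ℂ)).cexp
    rw [this.deriv, explorationKernel]
    simp only [Nat.cast_zero, add_zero, pow_zero, zero_mul, Complex.exp_zero, mul_one]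
    have h : (2 * s + 2 * s ^ 2) * x * Complex.exp (2 * s) * s = (2 + 2 * s) * phase x s := by
      unfold phase
      ring
    linear_combination (Complex.exp (potential x s) * Complex.exp (n * phase x s) *
      (1 / 2 - phase x s - s + n)) * h
  have h1 := circleCoeff_mul_deriv (n := n) hρ (fun s _ => (hWd s).hasDerivAt)
    hWd.deriv.continuous.continuousOn
  simp only [hder] at h1
  have hk := (differentiable_explorationKernel x n 0 0 0).continuous
  have hφ := (differentiable_phase x).continuous
  have e1 := circleCoeff_add (ρ := ρ) (n := n) (f := fun s => explorationKernel x n 0 0 0 s *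
    (s + phase x s)) (g := fun s => n * (W s - explorationKernel x n 0 0 0 s)) hρ
    (by fun_prop) (by have := hWd.continuous; fun_prop)
  have e2 := circleCoeff_add (ρ := ρ) (n := n) (f := W)
    (g := fun s => -1 * explorationKernel x n 0 0 0 s) hρ
    hWd.continuous.continuousOn (by fun_prop)
  have e3 : (fun s => W s - explorationKernel x n 0 0 0 s) =
      fun s => W s + -1 * explorationKernel x n 0 0 0 s := by
    ext s
    ring
  rw [circleCoeff_const_mul] at e1 e2
  rw [e1, e3, e2] at h1
  linear_combination -h1

lemma explorationWeight_no_root (hρ : 0 < ρ) (x : ℂ) (n : ℕ) :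
    explorationWeight ρ x (n + 1) 0 0 0 =
      explorationWeight ρ x n 1 0 0 + explorationWeight ρ x n 0 1 0 := by
  have h := circleCoeff_potential hρ x (n + 1)
  have h1 : (fun s => explorationKernel x (n + 1) 0 0 0 s * (s + phase x s)) =
      fun s => s ^ 1 * (explorationKernel x n 1 0 0 s + explorationKernel x n 0 1 0 s) := by
    ext s
    simp only [explorationKernel, phase, pow_one, pow_zero, Complex.exp_add, mul_add, add_mul,
      Nat.cast_add, Nat.cast_zero, Nat.cast_one, zero_mul, Complex.exp_zero, mul_one, one_mul,
      add_zero]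
    ring
  have hk1 := (differentiable_explorationKernel x n 1 0 0).continuous
  have hk2 := (differentiable_explorationKernel x n 0 1 0).continuous
  rw [h1, circleCoeff_pow_mul_of_le hρ (by omega), Nat.add_sub_cancel,
    circleCoeff_add hρ hk1.continuousOn hk2.continuousOn] at h
  simp only [explorationWeight, Nat.factorial_succ, Nat.cast_mul]
  linear_combination (n.factorial : ℂ) * h

/-- The generating polynomial of maximal matchings of forests as a contour integral. -/
lemma sum_pow_ncard (hρ : 0 < ρ) (x : ℂ) (n : ℕ) [Fintype (MMSpace n)] :
    (n : ℂ) ^ 2 * ∑ p : MMSpace n, x ^ p.val.2.ncard = n.factorial * circleCoeff ρ n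
      (fun s => Complex.exp (potential x s + n * phase x s) * amplitude x s) := by
  have h := weight_eq_of_recursion (x := x) (explorationWeight_zero hρ x)
    (explorationWeight_unmatched hρ x) (explorationWeight_half hρ x)
    (explorationWeight_matched hρ x) (explorationWeight_no_root hρ x)
    (fun _ : Fin n => VertexState.free)
  rw [weight_free_eq] at h
  rw [h]
  simp only [stateCount, reduceCtorEq, Finset.filter_true, Finset.filter_false, Finset.card_univ,
    Finset.card_empty, Fintype.card_fin, explorationWeight]
  set W : ℂ → ℂ := fun s =>
    Complex.exp (potential x s) * Complex.exp (n * phase x s) * (phase x s + s) with hW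
  have hWd : Differentiable ℂ W := by fun_prop
  have hder : ∀ s, s * deriv W s =
      Complex.exp (potential x s + n * phase x s) * amplitude x s +
      n * (W s + -1 * (explorationKernel x n 0 0 0 s * (s + phase x s))) := by
    intro s
    have : HasDerivAt W _ s := ((hasDerivAt_potential x s).cexp.mul
      ((hasDerivAt_phase x s).const_mul (n : ℂ)).cexp).mul
        ((hasDerivAt_phase x s).add (hasDerivAt_id s))
    rw [this.deriv, explorationKernel, amplitude, Complex.exp_add]
    simp only [Nat.cast_zero, add_zero, pow_zero, zero_mul, Complex.exp_zero, mul_one,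
      Pi.mul_apply]
    have h : (2 * s + 2 * s ^ 2) * x * Complex.exp (2 * s) * s = (2 + 2 * s) * phase x s := by
      unfold phase
      ring
    linear_combination (Complex.exp (potential x s) * Complex.exp (n * phase x s) *
      ((1 / 2 - phase x s - s + n) * (phase x s + s) + 1)) * h
  have h1 := circleCoeff_mul_deriv (n := n) hρ (fun s _ => (hWd s).hasDerivAt)
    hWd.deriv.continuous.continuousOn
  simp only [hder] at h1
  have hk := (differentiable_explorationKernel x n 0 0 0).continuous
  have hφ := (differentiable_phase x).continuous
  have hp := (differentiable_potential x).continuous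
  have ha := (differentiable_amplitude x).continuous
  have e1 := circleCoeff_add (ρ := ρ) (n := n)
    (f := fun s => Complex.exp (potential x s + n * phase x s) * amplitude x s)
    (g := fun s => n * (W s + -1 * (explorationKernel x n 0 0 0 s * (s + phase x s)))) hρ
    (by fun_prop) (by have := hWd.continuous; fun_prop)
  have e2 := circleCoeff_add (ρ := ρ) (n := n) (f := W)
    (g := fun s => -1 * (explorationKernel x n 0 0 0 s * (s + phase x s))) hρ
    hWd.continuous.continuousOn (by fun_prop)
  rw [circleCoeff_const_mul] at e1 e2
  rw [e1, e2, ← circleCoeff_potential hρ] at h1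
  linear_combination -(n.factorial : ℂ) * h1

end ExplorationWeight

/-! ### Moments as contour integrals -/

section Moments

variable {ρ : ℝ}

/-- Differentiation of a coefficient integral with respect to a parameter. -/
lemma hasDerivAt_circleCoeff (hρ : 0 < ρ) (n : ℕ) {F F' : ℂ → ℂ → ℂ}
    (hF : ∀ t, Continuous (F t)) (hF' : Continuous (Function.uncurry F'))
    (hd : ∀ t s, HasDerivAt (fun t => F t s) (F' t s) t) (t₀ : ℂ) :
    HasDerivAt (fun t => circleCoeff ρ n (F t)) (circleCoeff ρ n (F' t₀)) t₀ := by
  have hmem : ∀ θ, circleMap (0 : ℂ) ρ θ ∈ Metric.sphere (0 : ℂ) ρ :=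
    circleMap_mem_sphere 0 hρ.le
  have hF't : ∀ t, Continuous (F' t) := fun t => hF'.comp (by fun_prop : Continuous (t, ·))
  have hint : ∀ f : ℂ → ℂ, Continuous f → IntervalIntegrable
      (fun θ => deriv (circleMap 0 ρ) θ • (f (circleMap 0 ρ θ) / circleMap 0 ρ θ ^ (n + 1)))
      volume 0 (2 * Real.pi) := fun f hf =>
    (circleIntegrable_div_pow hρ n hf.continuousOn).out
  obtain ⟨C, hC⟩ := ((isCompact_closedBall t₀ 1).prod
    (isCompact_sphere (0 : ℂ) ρ)).exists_bound_of_continuousOn hF'.continuousOn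
  refine HasDerivAt.const_mul _ ?_
  refine (intervalIntegral.hasDerivAt_integral_of_dominated_loc_of_deriv_le
    (F := fun t θ => deriv (circleMap 0 ρ) θ • (F t (circleMap 0 ρ θ) / circleMap 0 ρ θ ^ (n + 1)))
    (F' := fun t θ =>
      deriv (circleMap 0 ρ) θ • (F' t (circleMap 0 ρ θ) / circleMap 0 ρ θ ^ (n + 1)))
    (bound := fun _ => ρ * (C / ρ ^ (n + 1))) (Metric.closedBall_mem_nhds t₀ one_pos)
    ?_ (hint _ (hF t₀)) ?_ ?_ intervalIntegrable_const ?_).2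
  · exact Eventually.of_forall fun t =>
      (intervalIntegrable_iff.1 (hint _ (hF t))).aestronglyMeasurable
  · exact (intervalIntegrable_iff.1 (hint _ (hF't t₀))).aestronglyMeasurable
  · refine Eventually.of_forall fun θ _ t ht => ?_
    have hb : ‖F' t (circleMap 0 ρ θ)‖ ≤ C := hC (t, circleMap 0 ρ θ) ⟨ht, hmem θ⟩
    have h1 : ‖deriv (circleMap 0 ρ) θ‖ = ρ := by simp [abs_of_pos hρ]
    have h2 : ‖circleMap 0 ρ θ‖ = ρ := by simp [abs_of_pos hρ]
    rw [norm_smul, norm_div, norm_pow, h1, h2]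
    gcongr
  · refine Eventually.of_forall fun θ _ t ht => ?_
    simp only [smul_eq_mul]
    exact ((hd t _).div_const _).const_mul _

/-- The first two moments of the matching number, centred at an arbitrary multiple of `n`,
as contour integrals. The corrections `A₁` and `A₂` do not depend on `n`. -/
lemma exists_moment_integrals (hρ : 0 < ρ) (d₀ : ℂ) :
    ∃ A₁ A₂ : ℂ → ℂ, Differentiable ℂ A₁ ∧ Differentiable ℂ A₂ ∧
      ∀ (n : ℕ) [Fintype (MMSpace n)],
        (n : ℂ) ^ 2 * ∑ p : MMSpace n, (p.val.2.ncard - n * d₀) =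
          n.factorial * circleCoeff ρ n (fun s =>
            Complex.exp (potential 1 s + n * phase 1 s) *
              (n * ((phase 1 s - d₀) * amplitude 1 s) + A₁ s)) ∧
        (n : ℂ) ^ 2 * ∑ p : MMSpace n, (p.val.2.ncard - n * d₀) ^ 2 =
          n.factorial * circleCoeff ρ n (fun s =>
            Complex.exp (potential 1 s + n * phase 1 s) *
              (n ^ 2 * ((phase 1 s - d₀) ^ 2 * amplitude 1 s) +
                n * (phase 1 s * amplitude 1 s + 2 * (phase 1 s - d₀) * A₁ s) + A₂ s)) := by
  set P₁ : ℂ → ℂ → ℂ := fun d s => d / 2 - d ^ 2 - s * d with hP₁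
  set P₂ : ℂ → ℂ → ℂ := fun d s => d / 2 - 2 * d ^ 2 - s * d with hP₂
  set Q₁ : ℂ → ℂ → ℂ := fun d s => (2 + 2 * s) * d + 2 * (d + s) * d * (1 - (2 + 2 * s) * d) -
    (d + s) ^ 2 * ((2 + 2 * s) * d) with hQ₁
  set Q₂ : ℂ → ℂ → ℂ := fun d s => (2 + 2 * s) * d +
    2 * d * ((2 * d + s) * (1 - (2 + 2 * s) * d) - (d + s) * ((2 + 2 * s) * d)) -
    (2 * (d + s) * d * ((2 + 2 * s) * d) + (d + s) ^ 2 * ((2 + 2 * s) * d)) with hQ₂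
  set A₁ : ℂ → ℂ → ℂ := fun x s => P₁ (phase x s) s * amplitude x s + Q₁ (phase x s) s with hA₁
  set A₂ : ℂ → ℂ → ℂ := fun x s => P₁ (phase x s) s * A₁ x s + P₂ (phase x s) s * amplitude x s +
    P₁ (phase x s) s * Q₁ (phase x s) s + Q₂ (phase x s) s with hA₂
  have hφ : ∀ t s, HasDerivAt (fun t => phase (Complex.exp t) s) (phase (Complex.exp t) s) t := by
    intro t s
    refine (((Complex.hasDerivAt_exp t).mul_const _).mul_const _)
  have hpot : ∀ t s, HasDerivAt (fun t => potential (Complex.exp t) s)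
      (P₁ (phase (Complex.exp t) s) s) t := by
    intro t s
    refine ((((hφ t s).div_const 2).const_add s |>.sub
      (((hφ t s).pow 2).div_const 2)).sub ((hφ t s).const_mul s)).congr_deriv ?_
    simp only [hP₁]
    push_cast
    ring
  have hamp : ∀ t s, HasDerivAt (fun t => amplitude (Complex.exp t) s)
      (Q₁ (phase (Complex.exp t) s) s) t := by
    intro t s
    have h := hφ t s
    refine (((h.const_mul (2 + 2 * s)).const_add s).add (((h.add_const s).pow 2).mul
      ((h.const_mul (2 + 2 * s)).const_sub 1))).congr_deriv ?_
    simp only [hQ₁, Pi.pow_apply]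
    push_cast
    ring
  have hA₁d : ∀ t s, HasDerivAt (fun t => A₁ (Complex.exp t) s)
      (P₂ (phase (Complex.exp t) s) s * amplitude (Complex.exp t) s +
        P₁ (phase (Complex.exp t) s) s * Q₁ (phase (Complex.exp t) s) s +
        Q₂ (phase (Complex.exp t) s) s) t := by
    intro t s
    have h := hφ t s
    have hp : HasDerivAt (fun t => P₁ (phase (Complex.exp t) s) s)
        (P₂ (phase (Complex.exp t) s) s) t := by
      refine (((h.div_const 2).sub (h.pow 2)).sub (h.const_mul s)).congr_deriv ?_
      simp only [hP₂]
      push_cast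
      ring
    have hq : HasDerivAt (fun t => Q₁ (phase (Complex.exp t) s) s)
        (Q₂ (phase (Complex.exp t) s) s) t := by
      refine (((h.const_mul (2 + 2 * s)).add ((((h.add_const s).const_mul 2).mul h).mul
        ((h.const_mul (2 + 2 * s)).const_sub 1))).sub (((h.add_const s).pow 2).mul
        (h.const_mul (2 + 2 * s)))).congr_deriv ?_
      simp only [hQ₂, Pi.pow_apply, Pi.mul_apply]
      push_cast
      ring
    exact (hp.mul (hamp t s)).add hq
  have hexp : ∀ (n : ℕ) (t s : ℂ), HasDerivAt
      (fun t => Complex.exp (potential (Complex.exp t) s +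
        n * (phase (Complex.exp t) s - t * d₀)))
      (Complex.exp (potential (Complex.exp t) s + n * (phase (Complex.exp t) s - t * d₀)) *
        (P₁ (phase (Complex.exp t) s) s + n * (phase (Complex.exp t) s - d₀))) t := by
    intro n t s
    refine ((hpot t s).add (((hφ t s).sub
      ((hasDerivAt_id t).mul_const d₀)).const_mul (n : ℂ))).cexp.congr_deriv ?_
    simp
  refine ⟨A₁ 1, A₂ 1, ?_, ?_, fun n _ => ?_⟩
  · simp only [hA₁, hP₁, hQ₁]
    fun_prop
  · simp only [hA₂, hA₁, hP₁, hQ₁, hP₂, hQ₂]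
    fun_prop
  set F₀ : ℂ → ℂ → ℂ := fun t s => Complex.exp (potential (Complex.exp t) s +
    n * (phase (Complex.exp t) s - t * d₀)) * amplitude (Complex.exp t) s with hF₀
  set F₁ : ℂ → ℂ → ℂ := fun t s => Complex.exp (potential (Complex.exp t) s +
    n * (phase (Complex.exp t) s - t * d₀)) *
      (n * ((phase (Complex.exp t) s - d₀) * amplitude (Complex.exp t) s) +
        A₁ (Complex.exp t) s) with hF₁
  set F₂ : ℂ → ℂ → ℂ := fun t s => Complex.exp (potential (Complex.exp t) s +
    n * (phase (Complex.exp t) s - t * d₀)) *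
      (n ^ 2 * ((phase (Complex.exp t) s - d₀) ^ 2 * amplitude (Complex.exp t) s) +
        n * (phase (Complex.exp t) s * amplitude (Complex.exp t) s +
          2 * (phase (Complex.exp t) s - d₀) * A₁ (Complex.exp t) s) +
        A₂ (Complex.exp t) s) with hF₂
  have hφc : Continuous fun q : ℂ × ℂ => phase (Complex.exp q.1) q.2 := by
    unfold phase
    fun_prop
  have hpc : Continuous fun q : ℂ × ℂ => potential (Complex.exp q.1) q.2 := by
    unfold potential
    fun_prop
  have hac : Continuous fun q : ℂ × ℂ => amplitude (Complex.exp q.1) q.2 := by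
    unfold amplitude
    fun_prop
  have hF₀c : Continuous (Function.uncurry F₀) := by
    simp only [hF₀, Function.uncurry_def]
    fun_prop
  have hF₁c : Continuous (Function.uncurry F₁) := by
    simp only [hF₁, hA₁, hP₁, hQ₁, Function.uncurry_def]
    fun_prop
  have hF₂c : Continuous (Function.uncurry F₂) := by
    simp only [hF₂, hA₂, hA₁, hP₁, hP₂, hQ₁, hQ₂, Function.uncurry_def]
    fun_prop
  have hd₀ : ∀ t s, HasDerivAt (fun t => F₀ t s) (F₁ t s) t := by
    intro t s
    refine ((hexp n t s).mul (hamp t s)).congr_deriv ?_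
    simp only [hF₁, hA₁]
    ring
  have hd₁ : ∀ t s, HasDerivAt (fun t => F₁ t s) (F₂ t s) t := by
    intro t s
    refine ((hexp n t s).mul (((((hφ t s).sub_const d₀).mul (hamp t s)).const_mul
      (n : ℂ)).add (hA₁d t s))).congr_deriv ?_
    simp only [hF₂, hA₂, hA₁, Pi.mul_apply, Pi.add_apply]
    ring
  have hS : ∀ t, (n : ℂ) ^ 2 * ∑ p : MMSpace n, Complex.exp (t * (p.val.2.ncard - n * d₀)) =
      n.factorial * circleCoeff ρ n (F₀ t) := by
    intro t
    have h := sum_pow_ncard hρ (Complex.exp t) n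
    have h1 : F₀ t = fun s => Complex.exp (-(n * t * d₀)) *
        (Complex.exp (potential (Complex.exp t) s + n * phase (Complex.exp t) s) *
          amplitude (Complex.exp t) s) := by
      ext s
      rw [← mul_assoc, ← Complex.exp_add, hF₀]
      ring_nf
    rw [h1, circleCoeff_const_mul, mul_left_comm, ← h, mul_left_comm]
    congr 1
    rw [Finset.mul_sum]
    refine Finset.sum_congr rfl fun p _ => ?_
    rw [← Complex.exp_nat_mul, ← Complex.exp_add]
    ring_nf
  have hdS : ∀ (j : ℕ) (t : ℂ), HasDerivAt
      (fun t => (n : ℂ) ^ 2 * ∑ p : MMSpace n, (p.val.2.ncard - n * d₀) ^ j *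
        Complex.exp (t * (p.val.2.ncard - n * d₀)))
      ((n : ℂ) ^ 2 * ∑ p : MMSpace n, (p.val.2.ncard - n * d₀) ^ (j + 1) *
        Complex.exp (t * (p.val.2.ncard - n * d₀))) t := by
    intro j t
    refine (HasDerivAt.fun_sum fun p _ => ?_).const_mul _
    refine ((((hasDerivAt_id t).mul_const _).cexp).const_mul _).congr_deriv ?_
    simp only [id]
    ring
  have h1 : ∀ t, (n : ℂ) ^ 2 * ∑ p : MMSpace n, (p.val.2.ncard - n * d₀) ^ 1 *
      Complex.exp (t * (p.val.2.ncard - n * d₀)) = n.factorial * circleCoeff ρ n (F₁ t) := by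
    intro t
    have e := hdS 0 t
    simp only [pow_zero, one_mul, hS] at e
    exact e.unique ((hasDerivAt_circleCoeff hρ n
      (fun t => hF₀c.comp (by fun_prop : Continuous (t, ·))) hF₁c hd₀ t).const_mul _)
  have h2 : ∀ t, (n : ℂ) ^ 2 * ∑ p : MMSpace n, (p.val.2.ncard - n * d₀) ^ 2 *
      Complex.exp (t * (p.val.2.ncard - n * d₀)) = n.factorial * circleCoeff ρ n (F₂ t) := by
    intro t
    have e := hdS 1 t
    simp only [h1] at e
    exact e.unique ((hasDerivAt_circleCoeff hρ n
      (fun t => hF₁c.comp (by fun_prop : Continuous (t, ·))) hF₂c hd₁ t).const_mul _)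
  have h1' := h1 0
  have h2' := h2 0
  simp only [hF₁, hF₂, zero_mul, Complex.exp_zero, mul_one, sub_zero, pow_one] at h1' h2'
  exact ⟨h1', h2'⟩

end Moments

/-! ### A lower bound for the central coefficient -/

section LowerBound

lemma factorial_le_exp {k : ℕ} (hk : 1 ≤ k) :
    (k.factorial : ℝ) ≤ Real.exp 1 * k * Real.exp (k * Real.log k - k) := by
  obtain ⟨m, rfl⟩ : ∃ m, k = m + 1 := ⟨k - 1, by omega⟩
  have h1 := Stirling.stirlingSeq'_antitone (Nat.zero_le m)
  simp only [Function.comp, Nat.succ_eq_add_one, zero_add, Stirling.stirlingSeq_one] at h1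
  rw [Stirling.stirlingSeq] at h1
  have hpos : (0 : ℝ) < (m + 1 : ℕ) := by positivity
  rw [div_le_iff₀ (by positivity)] at h1
  have h2 : (((m + 1 : ℕ) : ℝ) / Real.exp 1) ^ (m + 1) =
      Real.exp ((m + 1 : ℕ) * Real.log (m + 1 : ℕ) - (m + 1 : ℕ)) := by
    rw [div_pow, Real.exp_sub, mul_comm ((m + 1 : ℕ) : ℝ) (Real.log _), Real.exp_mul,
      Real.exp_log hpos, Real.rpow_natCast, ← Real.exp_nat_mul, mul_one]
  rw [h2, Real.sqrt_mul zero_le_two, ← mul_assoc, ← mul_assoc,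
    div_mul_cancel₀ _ (by positivity)] at h1
  refine h1.trans ?_
  gcongr
  rw [Real.sqrt_le_left (by positivity)]
  have : (1 : ℝ) ≤ (m + 1 : ℕ) := by exact_mod_cast hk
  nlinarith

lemma sub_sub_mul_log_ge {a b : ℝ} (ha : 0 < a) (hb : 0 < b) :
    -((a - b) ^ 2 / b) ≤ a - b - a * Real.log (a / b) := by
  have h := Real.log_le_sub_one_of_pos (div_pos ha hb)
  have h2 : a * Real.log (a / b) ≤ a * (a / b - 1) := by gcongr
  have h3 : -((a - b) ^ 2 / b) = a - b - a * (a / b - 1) := by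
    field_simp
    ring
  linarith

/-- A single term of the central coefficient is within a polynomial factor of the
saddle point bound. -/
lemma exists_large_term {s κ : ℝ} (hs : 0 < s) (hκ : κ = s ^ 2 * Real.exp (2 * s))
    (h1 : (2 + 2 * s) * κ = 1) :
    ∃ c > 0, ∀ n : ℕ, 1 ≤ κ * n → ∃ k : ℕ, 2 * k ≤ n ∧
      c / (n : ℝ) ^ 2 * (Real.exp (n * κ) / s ^ n) ≤
        ((n : ℝ) ^ k / k.factorial) * ((2 * k : ℝ) ^ (n - 2 * k) / (n - 2 * k).factorial) := by
  have hκ0 : 0 < κ := by rw [hκ]; positivity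
  refine ⟨Real.exp (-(1 / κ) - 1 / (κ ^ 2 * (2 * s))) / Real.exp 1 ^ 2, by positivity,
    fun n hn => ?_⟩
  have hn0 : (0 : ℝ) < n := by
    by_contra h
    have : (n : ℝ) ≤ 0 := not_lt.1 h
    nlinarith
  set k := ⌊κ * n⌋₊ with hk
  have hk1 : 1 ≤ k := Nat.le_floor (by simpa using hn)
  have hkle : (k : ℝ) ≤ κ * n := Nat.floor_le (by positivity)
  have hklt : κ * n < k + 1 := Nat.lt_floor_add_one _
  have hk0 : (0 : ℝ) < k := by exact_mod_cast hk1
  have h2κ : 2 * κ < 1 := by nlinarith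
  have h2k : 2 * k < n := by
    have : (2 * k : ℝ) < n := by nlinarith
    exact_mod_cast this
  refine ⟨k, h2k.le, ?_⟩
  set l := n - 2 * k with hl
  have hl1 : 1 ≤ l := by omega
  have hl0 : (0 : ℝ) < l := by exact_mod_cast hl1
  have hnkl : (n : ℝ) = l + 2 * k := by
    rw [hl, Nat.cast_sub h2k.le]
    push_cast
    ring
  have hfk := factorial_le_exp hk1
  have hfl := factorial_le_exp hl1
  have hlog : Real.log κ = 2 * Real.log s + 2 * s := by
    rw [hκ, Real.log_mul (by positivity) (by positivity), Real.log_exp, Real.log_pow]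
    push_cast
    ring
  have hA := sub_sub_mul_log_ge hk0 (mul_pos hκ0 hn0)
  have hB := sub_sub_mul_log_ge hl0 (by positivity : 0 < 2 * k * s)
  have hsq : (κ * n - k) ^ 2 ≤ 1 := by
    rw [sq_le_one_iff_abs_le_one, abs_le]
    constructor <;> linarith
  have hA' : (k - κ * n) ^ 2 / (κ * n) ≤ 1 / κ := by
    rw [div_le_div_iff₀ (by positivity) hκ0]
    rw [← neg_sub, neg_sq]
    have hn1 : (1 : ℝ) ≤ n := by
      have : 1 ≤ n := by omega
      exact_mod_cast this
    calc (κ * n - k) ^ 2 * κ ≤ 1 * κ := by gcongr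
      _ ≤ 1 * (κ * n) := by nlinarith
  have hlk : (l : ℝ) - 2 * k * s = (κ * n - k) / κ := by
    field_simp
    linear_combination (-κ) * hnkl - k * h1
  have hB' : (l - 2 * k * s) ^ 2 / (2 * k * s) ≤ 1 / (κ ^ 2 * (2 * s)) := by
    rw [hlk, div_pow, div_div, div_le_div_iff₀ (by positivity) (by positivity)]
    have h4 : (1 : ℝ) ≤ k := by exact_mod_cast hk1
    calc (κ * n - k) ^ 2 * (κ ^ 2 * (2 * s)) ≤ 1 * (κ ^ 2 * (2 * s)) := by gcongr
      _ ≤ k * (κ ^ 2 * (2 * s)) := by gcongr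
      _ = 1 * (κ ^ 2 * (2 * k * s)) := by ring
  rw [Real.log_div hk0.ne' (by positivity), Real.log_mul hκ0.ne' hn0.ne', hlog] at hA
  rw [Real.log_div hl0.ne' (by positivity), Real.log_mul (by positivity) hs.ne'] at hB
  have hpow : ∀ (x : ℝ) (m : ℕ), 0 < x → x ^ m = Real.exp (m * Real.log x) := by
    intro x m hx
    rw [Real.exp_nat_mul, Real.exp_log hx]
  have hterm : Real.exp (k * Real.log n) / (Real.exp 1 * k * Real.exp (k * Real.log k - k)) *
      (Real.exp (l * Real.log (2 * k)) / (Real.exp 1 * l * Real.exp (l * Real.log l - l))) ≤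
      ((n : ℝ) ^ k / k.factorial) * ((2 * k : ℝ) ^ l / l.factorial) := by
    rw [← hpow _ _ hn0, ← hpow _ _ (by positivity : (0 : ℝ) < 2 * k)]
    gcongr
  refine le_trans ?_ hterm
  have e1 : Real.exp (k * Real.log n) / (Real.exp 1 * k * Real.exp (k * Real.log k - k)) *
      (Real.exp (l * Real.log (2 * k)) / (Real.exp 1 * l * Real.exp (l * Real.log l - l))) =
      1 / (Real.exp 1 ^ 2 * (k * l)) * Real.exp (k * Real.log n - (k * Real.log k - k) +
        (l * Real.log (2 * k) - (l * Real.log l - l))) := by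
    rw [Real.exp_add, Real.exp_sub (k * Real.log n), Real.exp_sub (l * Real.log (2 * k)),
      div_mul_div_comm, div_mul_div_comm, div_mul_div_comm, one_mul]
    congr 1
    ring
  have e2 : Real.exp (-(1 / κ) - 1 / (κ ^ 2 * (2 * s))) / Real.exp 1 ^ 2 / (n : ℝ) ^ 2 *
      (Real.exp (n * κ) / s ^ n) = 1 / (Real.exp 1 ^ 2 * n ^ 2) *
        Real.exp (-(1 / κ) - 1 / (κ ^ 2 * (2 * s)) + (n * κ - n * Real.log s)) := by
    rw [hpow s n hs, Real.exp_add, Real.exp_sub (n * κ)]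
    ring
  rw [e1, e2]
  have hkl : (k * l : ℝ) ≤ n ^ 2 := by
    rw [pow_two]
    exact mul_le_mul (by linarith) (by linarith) hl0.le hn0.le
  refine mul_le_mul (by gcongr) (Real.exp_le_exp.2 ?_) (Real.exp_nonneg _) (by positivity)
  have hns : (n : ℝ) * Real.log s = l * Real.log s + 2 * k * Real.log s := by
    rw [hnkl]
    ring
  have hA2 : (k : ℝ) - κ * n - k * (Real.log k - (2 * Real.log s + 2 * s + Real.log n)) =
      k - n * κ - k * Real.log k + 2 * k * Real.log s + 2 * k * s + k * Real.log n := by ring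
  have hB2 : (l : ℝ) - 2 * k * s - l * (Real.log l - (Real.log (2 * k) + Real.log s)) =
      l - 2 * k * s - l * Real.log l + l * Real.log (2 * k) + l * Real.log s := by ring
  rw [hns]
  linarith

end LowerBound

section CentralCoefficient

variable {ρ : ℝ}

lemma circleCoeff_const_of_pos (hρ : 0 < ρ) {n : ℕ} (hn : n ≠ 0) (c : ℂ) :
    circleCoeff ρ n (fun _ => c) = 0 := by
  have h := circleCoeff_mul_deriv (n := n) hρ (W := fun _ => c) (W' := fun _ => 0)
    (fun s _ => hasDerivAt_const s c) continuousOn_const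
  have h0 := circleCoeff_const_mul (ρ := ρ) (n := n) 0 (fun _ => (0 : ℂ))
  simp only [zero_mul] at h0
  simp only [mul_zero, h0] at h
  have hn' : (n : ℂ) ≠ 0 := by exact_mod_cast hn
  simpa [hn'] using h.symm

lemma circleCoeff_exp_mul (hρ : 0 < ρ) (n : ℕ) (c : ℂ) :
    circleCoeff ρ n (fun s => Complex.exp (s * c)) = c ^ n / n.factorial := by
  have h := circleCoeff_mul_exp (n := n) hρ (f := fun _ => 1) (ψ := fun _ => c)
    (by fun_prop) (by fun_prop)
  simp only [one_mul] at h
  rw [h, Finset.sum_eq_single n]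
  · rw [Nat.sub_self, circleCoeff_zero hρ (by fun_prop), inv_mul_eq_div]
  · intro j hj hjn
    have : n - j ≠ 0 := by
      have := Finset.mem_range.1 hj
      omega
    rw [circleCoeff_const_of_pos hρ this, mul_zero]
  · simp

lemma circleCoeff_exp_phase (hρ : 0 < ρ) (n : ℕ) :
    circleCoeff ρ n (fun s => Complex.exp (n * phase 1 s)) =
      ((∑ j ∈ Finset.range (n + 1), if 2 * j ≤ n then
        ((n : ℝ) ^ j / j.factorial) * ((2 * j : ℝ) ^ (n - 2 * j) / (n - 2 * j).factorial)
          else 0 : ℝ) : ℂ) := by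
  have h := circleCoeff_mul_exp (n := n) hρ (f := fun _ => 1)
    (ψ := fun s => n * (s * Complex.exp (2 * s))) (by fun_prop) (by fun_prop)
  have e : ∀ s, (1 : ℂ) * Complex.exp (s * (n * (s * Complex.exp (2 * s)))) =
      Complex.exp (n * phase 1 s) := by
    intro s
    rw [phase]
    ring_nf
  simp only [e] at h
  rw [h]
  push_cast
  refine Finset.sum_congr rfl fun j hj => ?_
  have hj : j ≤ n := by simpa [Nat.lt_succ_iff] using hj
  have e2 : (fun s : ℂ => 1 * (n * (s * Complex.exp (2 * s))) ^ j) =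
      fun s => (n : ℂ) ^ j * (s ^ j * Complex.exp (s * (2 * j))) := by
    ext s
    rw [mul_pow, mul_pow, ← Complex.exp_nat_mul]
    ring_nf
  rw [e2, circleCoeff_const_mul]
  split_ifs with h2
  · rw [circleCoeff_pow_mul_of_le hρ (by omega), circleCoeff_exp_mul hρ,
      show n - j - j = n - 2 * j by omega]
    push_cast
    ring
  · rw [circleCoeff_pow_mul_of_lt hρ (by omega) (by fun_prop)]
    simp

lemma exists_le_circleCoeff_exp_phase {κ : ℝ} (hρ : 0 < ρ) (hκ : κ = ρ ^ 2 * Real.exp (2 * ρ))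
    (h1 : (2 + 2 * ρ) * κ = 1) :
    ∃ c > 0, ∀ n : ℕ, 1 ≤ κ * n → c / (n : ℝ) ^ 2 * (Real.exp (n * κ) / ρ ^ n) ≤
      ‖circleCoeff ρ n (fun s => Complex.exp (n * phase 1 s))‖ := by
  obtain ⟨c, hc, h⟩ := exists_large_term hρ hκ h1
  refine ⟨c, hc, fun n hn => ?_⟩
  obtain ⟨k, hk, hle⟩ := h n hn
  rw [circleCoeff_exp_phase hρ, Complex.norm_real]
  refine hle.trans (le_trans ?_ (Real.le_norm_self _))
  refine le_trans (by rw [if_pos hk]) (Finset.single_le_sum (fun j _ => ?_)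
    (Finset.mem_range.2 (by omega : k < n + 1)))
  split_ifs <;> positivity

end CentralCoefficient

section Saddle

variable {ρ κ : ℝ}

/-- The function `1 - s D'(s)`, with `D = phase 1`, which vanishes at the saddle points. -/
noncomputable def saddleFactor (s : ℂ) : ℂ := 1 - (2 + 2 * s) * phase 1 s

@[fun_prop]
lemma differentiable_saddleFactor : Differentiable ℂ saddleFactor := by
  unfold saddleFactor
  fun_prop

lemma exists_saddle : ∃ ρ : ℝ, 0 < ρ ∧ (2 + 2 * ρ) * (ρ ^ 2 * Real.exp (2 * ρ)) = 1 := by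
  have h : ContinuousOn (fun ρ : ℝ => (2 + 2 * ρ) * (ρ ^ 2 * Real.exp (2 * ρ))) (Set.Icc 0 1) := by
    fun_prop
  have h1 : (1 : ℝ) ≤ Real.exp (2 * 1) := Real.one_le_exp (by norm_num)
  obtain ⟨ρ, hρ, e⟩ := intermediate_value_Icc zero_le_one h
    (show (1 : ℝ) ∈ Set.Icc _ _ from ⟨by norm_num, by linarith⟩)
  refine ⟨ρ, hρ.1.lt_of_ne fun h0 => ?_, e⟩
  subst h0
  norm_num at e

lemma phase_ofReal (hκ : κ = ρ ^ 2 * Real.exp (2 * ρ)) : phase 1 ρ = κ := by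
  rw [phase, hκ]
  push_cast
  ring

lemma norm_phase {s : ℂ} (hs : s ∈ Metric.sphere (0 : ℂ) ρ) :
    ‖phase 1 s‖ = ρ ^ 2 * Real.exp (2 * s.re) := by
  rw [mem_sphere_zero_iff_norm] at hs
  rw [phase, one_mul, norm_mul, norm_pow, hs, Complex.norm_exp]
  simp

lemma re_phase_le (hκ : κ = ρ ^ 2 * Real.exp (2 * ρ)) {s : ℂ}
    (hs : s ∈ Metric.sphere (0 : ℂ) ρ) : (phase 1 s).re ≤ κ := by
  refine (Complex.re_le_norm _).trans ?_
  have h : s.re ≤ ρ := (Complex.re_le_norm s).trans (mem_sphere_zero_iff_norm.1 hs).le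
  rw [norm_phase hs, hκ]
  gcongr

lemma saddleFactor_ofReal (hκ : κ = ρ ^ 2 * Real.exp (2 * ρ)) (h1 : (2 + 2 * ρ) * κ = 1) :
    saddleFactor ρ = 0 := by
  rw [saddleFactor, phase_ofReal hκ, sub_eq_zero]
  exact_mod_cast h1.symm

lemma eq_of_saddleFactor_eq_zero (hρ : 0 < ρ) (hκ : κ = ρ ^ 2 * Real.exp (2 * ρ))
    (h1 : (2 + 2 * ρ) * κ = 1) {s : ℂ} (hs : s ∈ Metric.sphere (0 : ℂ) ρ)
    (h : saddleFactor s = 0) : s = ρ := by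
  have hsρ := mem_sphere_zero_iff_norm.1 hs
  have hn := congrArg norm (sub_eq_zero.1 h)
  rw [norm_one, norm_mul, norm_phase hs] at hn
  have h2 : ‖2 + 2 * s‖ ≤ 2 + 2 * ρ := by
    refine (norm_add_le _ _).trans ?_
    rw [norm_mul, hsρ]
    simp
  have h3 : ρ ≤ s.re := by
    by_contra! hlt
    have hexp : Real.exp (2 * s.re) < Real.exp (2 * ρ) := Real.exp_lt_exp.2 (by linarith)
    have : ‖2 + 2 * s‖ * (ρ ^ 2 * Real.exp (2 * s.re)) < (2 + 2 * ρ) * κ := by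
      rw [hκ]
      calc _ ≤ (2 + 2 * ρ) * (ρ ^ 2 * Real.exp (2 * s.re)) := by gcongr
        _ < _ := by gcongr
    linarith
  have h4 : s.re = ‖s‖ := le_antisymm (Complex.re_le_norm s) (hsρ.le.trans h3)
  have h5 := (Complex.re_eq_norm.1 h4).2
  exact Complex.ext (by simpa using h4.trans hsρ) (by simpa using h5.symm)

lemma hasDerivAt_saddleFactor (hκ : κ = ρ ^ 2 * Real.exp (2 * ρ)) (hρ : 0 < ρ) :
    HasDerivAt saddleFactor (-((2 * ρ + (2 + 2 * ρ) ^ 2) * κ / ρ : ℝ)) ρ := by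
  refine ((((hasDerivAt_id (ρ : ℂ)).const_mul 2).const_add 2).mul
    (hasDerivAt_phase 1 ρ)).const_sub 1 |>.congr_deriv ?_
  have hρ' : (ρ : ℂ) ≠ 0 := by exact_mod_cast hρ.ne'
  rw [phase_ofReal hκ, hκ]
  push_cast
  simp only [id]
  field_simp

/-- Division by `saddleFactor` in a neighbourhood of the circle through the saddle point. -/
lemma exists_open_forall_exists_eq (hρ : 0 < ρ) (hκ : κ = ρ ^ 2 * Real.exp (2 * ρ))
    (h1 : (2 + 2 * ρ) * κ = 1) :
    ∃ Ω : Set ℂ, IsOpen Ω ∧ Metric.sphere 0 ρ ⊆ Ω ∧ ∀ g : ℂ → ℂ, DifferentiableOn ℂ g Ω →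
      ∃ h : ℂ → ℂ, DifferentiableOn ℂ h Ω ∧
        ∀ s ∈ Ω, g s = g ρ + saddleFactor s * h s := by
  set B := dslope saddleFactor (ρ : ℂ) with hB
  have hF : ∀ s, saddleFactor s = (s - ρ) * B s := fun s => by
    have := sub_smul_dslope saddleFactor (ρ : ℂ) s
    rw [saddleFactor_ofReal hκ h1, sub_zero, smul_eq_mul] at this
    exact this.symm
  have hBd : Differentiable ℂ B := differentiableOn_univ.1
    ((Complex.differentiableOn_dslope univ_mem).2 differentiable_saddleFactor.differentiableOn)
  have hκ0 : 0 < κ := by rw [hκ]; positivity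
  have hB0 : ∀ s ∈ Metric.sphere (0 : ℂ) ρ, B s ≠ 0 := by
    intro s hs h0
    have := eq_of_saddleFactor_eq_zero hρ hκ h1 hs (by rw [hF, h0, mul_zero])
    rw [this, hB, dslope_same, (hasDerivAt_saddleFactor hκ hρ).deriv, neg_eq_zero,
      Complex.ofReal_eq_zero] at h0
    have : 0 < (2 * ρ + (2 + 2 * ρ) ^ 2) * κ / ρ := by positivity
    linarith
  refine ⟨{s | B s ≠ 0}, isOpen_ne_fun hBd.continuous continuous_const, hB0, fun g hg => ?_⟩
  have hmem : (ρ : ℂ) ∈ {s | B s ≠ 0} := hB0 ρ (by simp [abs_of_pos hρ])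
  have hnhds : {s | B s ≠ 0} ∈ 𝓝 (ρ : ℂ) :=
    (isOpen_ne_fun hBd.continuous continuous_const).mem_nhds hmem
  refine ⟨fun s => dslope g ρ s / B s, ((Complex.differentiableOn_dslope hnhds).2 hg).div
    hBd.differentiableOn fun s hs => hs, fun s hs => ?_⟩
  have h := sub_smul_dslope g (ρ : ℂ) s
  rw [smul_eq_mul] at h
  have hs' : B s ≠ 0 := hs
  rw [hF, mul_assoc, mul_div_cancel₀ _ hs', h]
  ring

end Saddle

section SaddleIntegral

variable {ρ κ : ℝ} {n : ℕ}

/-- The saddle point integral with amplitude `g`. -/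
noncomputable def saddleIntegral (ρ : ℝ) (n : ℕ) (g : ℂ → ℂ) : ℂ :=
  circleCoeff ρ n (fun s => g s * Complex.exp (n * phase 1 s))

lemma saddleIntegral_congr (hρ : 0 < ρ) {f g : ℂ → ℂ}
    (h : ∀ s ∈ Metric.sphere 0 ρ, f s = g s) : saddleIntegral ρ n f = saddleIntegral ρ n g :=
  circleCoeff_congr hρ fun s hs => by rw [h s hs]

lemma saddleIntegral_add (hρ : 0 < ρ) {f g : ℂ → ℂ} (hf : ContinuousOn f (Metric.sphere 0 ρ))
    (hg : ContinuousOn g (Metric.sphere 0 ρ)) :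
    saddleIntegral ρ n (fun s => f s + g s) = saddleIntegral ρ n f + saddleIntegral ρ n g := by
  have he : Continuous fun s => Complex.exp (n * phase 1 s) := by
    have := (differentiable_phase 1).continuous
    fun_prop
  simp only [saddleIntegral, add_mul]
  exact circleCoeff_add hρ (hf.mul he.continuousOn) (hg.mul he.continuousOn)

lemma saddleIntegral_const_mul (c : ℂ) (f : ℂ → ℂ) :
    saddleIntegral ρ n (fun s => c * f s) = c * saddleIntegral ρ n f := by
  simp only [saddleIntegral, mul_assoc]
  exact circleCoeff_const_mul _ _

/-- Integration by parts. -/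
lemma saddleIntegral_saddleFactor_mul (hρ : 0 < ρ) {Ω : Set ℂ} (hΩ : IsOpen Ω)
    (hsub : Metric.sphere 0 ρ ⊆ Ω) {h : ℂ → ℂ} (hh : DifferentiableOn ℂ h Ω) :
    n * saddleIntegral ρ n (fun s => saddleFactor s * h s) =
      saddleIntegral ρ n (fun s => s * deriv h s) := by
  have hd : ∀ s ∈ Metric.sphere (0 : ℂ) ρ, HasDerivAt h (deriv h s) s := fun s hs =>
    (hh.differentiableAt (hΩ.mem_nhds (hsub hs))).hasDerivAt
  have hhc : ContinuousOn h (Metric.sphere 0 ρ) := hh.continuousOn.mono hsub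
  have hdc : ContinuousOn (deriv h) (Metric.sphere 0 ρ) := (hh.deriv hΩ).continuousOn.mono hsub
  have hφ := (differentiable_phase 1).continuous
  have hsf := differentiable_saddleFactor.continuous
  have key := circleCoeff_mul_deriv (n := n) hρ (W := fun s => h s * Complex.exp (n * phase 1 s))
    (fun s hs => (hd s hs).mul ((hasDerivAt_phase 1 s).const_mul (n : ℂ)).cexp) (by fun_prop)
  have e : ∀ s, s * (deriv h s * Complex.exp (n * phase 1 s) + h s *
      (Complex.exp (n * phase 1 s) * (n * ((2 * s + 2 * s ^ 2) * 1 * Complex.exp (2 * s))))) =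
      ((s * deriv h s + n * h s) + (-n) * (saddleFactor s * h s)) *
        Complex.exp (n * phase 1 s) := by
    intro s
    rw [saddleFactor, phase]
    ring
  simp only [e] at key
  have key' : saddleIntegral ρ n (fun s => (s * deriv h s + n * h s) +
      (-n) * (saddleFactor s * h s)) = n * saddleIntegral ρ n h := key
  rw [saddleIntegral_add hρ (f := fun s => s * deriv h s + n * h s) (by fun_prop) (by fun_prop),
    saddleIntegral_add hρ (f := fun s => s * deriv h s) (by fun_prop) (by fun_prop),
    saddleIntegral_const_mul, saddleIntegral_const_mul] at key'
  linear_combination -key'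

lemma exists_norm_saddleIntegral_le (hρ : 0 < ρ) (hκ : κ = ρ ^ 2 * Real.exp (2 * ρ))
    {g : ℂ → ℂ} (hg : ContinuousOn g (Metric.sphere 0 ρ)) :
    ∃ C, 0 ≤ C ∧ ∀ n : ℕ, ‖saddleIntegral ρ n g‖ ≤ C * (Real.exp (n * κ) / ρ ^ n) := by
  obtain ⟨C, hC⟩ := (isCompact_sphere (0 : ℂ) ρ).exists_bound_of_continuousOn hg
  have hC0 : 0 ≤ C := (norm_nonneg _).trans (hC ρ (by simp [abs_of_pos hρ]))
  refine ⟨C, hC0, fun n => ?_⟩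
  have h := circleIntegral.norm_two_pi_i_inv_smul_integral_le_of_norm_le_const (c := 0) hρ.le
    (f := fun s => g s * Complex.exp (n * phase 1 s) / s ^ (n + 1))
    (C := C * Real.exp (n * κ) / ρ ^ (n + 1)) fun s hs => by
      rw [norm_div, norm_mul, norm_pow, mem_sphere_zero_iff_norm.1 hs, Complex.norm_exp]
      have h2 : (n * phase 1 s).re ≤ n * κ := by
        have := re_phase_le hκ hs
        simp only [Complex.mul_re, Complex.natCast_re, Complex.natCast_im, zero_mul, sub_zero]
        gcongr
      gcongr
      exact hC s hs
  refine h.trans (le_of_eq ?_)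
  field_simp
  ring

lemma saddleIntegral_eq_add (hρ : 0 < ρ) {Ω : Set ℂ} (hΩ : IsOpen Ω)
    (hsub : Metric.sphere 0 ρ ⊆ Ω) {g h : ℂ → ℂ} (hh : DifferentiableOn ℂ h Ω)
    (hgh : ∀ s ∈ Ω, g s = g ρ + saddleFactor s * h s) :
    n * saddleIntegral ρ n g = n * (g ρ * saddleIntegral ρ n (fun _ => 1)) +
      saddleIntegral ρ n (fun s => s * deriv h s) := by
  have hhc : ContinuousOn h (Metric.sphere 0 ρ) := hh.continuousOn.mono hsub
  have hsf := differentiable_saddleFactor.continuous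
  have e : saddleIntegral ρ n (fun _ => g ρ) = g ρ * saddleIntegral ρ n (fun _ => 1) := by
    rw [← saddleIntegral_const_mul]
    simp only [mul_one]
  rw [← saddleIntegral_saddleFactor_mul hρ hΩ hsub hh, ← e, ← mul_add,
    ← saddleIntegral_add hρ (by fun_prop) (by fun_prop),
    saddleIntegral_congr hρ fun s hs => hgh s (hsub hs)]

/-- A saddle point integral is at most of the order of the one with amplitude `1`. -/
lemma exists_norm_saddleIntegral_le_mul (hρ : 0 < ρ) (hκ : κ = ρ ^ 2 * Real.exp (2 * ρ))
    (h1 : (2 + 2 * ρ) * κ = 1) {Ω : Set ℂ} (hΩ : IsOpen Ω) (hsub : Metric.sphere 0 ρ ⊆ Ω)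
    (hdiv : ∀ g : ℂ → ℂ, DifferentiableOn ℂ g Ω → ∃ h : ℂ → ℂ, DifferentiableOn ℂ h Ω ∧
      ∀ s ∈ Ω, g s = g ρ + saddleFactor s * h s) {g : ℂ → ℂ} (hg : DifferentiableOn ℂ g Ω) :
    ∃ C, 0 ≤ C ∧ ∀ n : ℕ, 1 ≤ κ * n →
      ‖saddleIntegral ρ n g‖ ≤ C * ‖saddleIntegral ρ n (fun _ => 1)‖ := by
  have hn0 : ∀ n : ℕ, 1 ≤ κ * n → (0 : ℝ) < n := fun n hn => by
    rcases n.eq_zero_or_pos with rfl | h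
    · norm_num at hn
    · exact_mod_cast h
  have step : ∀ A : ℕ, (∀ g : ℂ → ℂ, DifferentiableOn ℂ g Ω → ∃ C, 0 ≤ C ∧ ∀ n : ℕ, 1 ≤ κ * n →
      ‖saddleIntegral ρ n g‖ ≤ C * n ^ (A + 1) * ‖saddleIntegral ρ n (fun _ => 1)‖) →
      ∀ g : ℂ → ℂ, DifferentiableOn ℂ g Ω → ∃ C, 0 ≤ C ∧ ∀ n : ℕ, 1 ≤ κ * n →
      ‖saddleIntegral ρ n g‖ ≤ C * n ^ A * ‖saddleIntegral ρ n (fun _ => 1)‖ := by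
    intro A hA g hg
    obtain ⟨h, hh, hgh⟩ := hdiv g hg
    obtain ⟨C, hC0, hC⟩ := hA (fun s => s * deriv h s) (differentiableOn_id.mul (hh.deriv hΩ))
    refine ⟨‖g ρ‖ + C, by positivity, fun n hn => ?_⟩
    have hn' := hn0 n hn
    have hn1 : (1 : ℝ) ≤ n := by exact_mod_cast hn'
    have e := congrArg norm (saddleIntegral_eq_add (n := n) hρ hΩ hsub hh hgh)
    rw [norm_mul, Complex.norm_natCast] at e
    have b := e.le.trans (norm_add_le _ _)
    rw [norm_mul, norm_mul, Complex.norm_natCast] at b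
    refine le_of_mul_le_mul_left ?_ hn'
    calc _ ≤ _ := b
      _ ≤ n * (‖g ρ‖ * ‖saddleIntegral ρ n (fun _ => 1)‖) +
          C * n ^ (A + 1) * ‖saddleIntegral ρ n (fun _ => 1)‖ := by gcongr; exact hC n hn
      _ ≤ n * (‖g ρ‖ * n ^ A * ‖saddleIntegral ρ n (fun _ => 1)‖) +
          C * n ^ (A + 1) * ‖saddleIntegral ρ n (fun _ => 1)‖ := by
        gcongr
        exact le_mul_of_one_le_right (norm_nonneg _) (one_le_pow₀ hn1)
      _ = _ := by ring
  have base : ∀ g : ℂ → ℂ, DifferentiableOn ℂ g Ω → ∃ C, 0 ≤ C ∧ ∀ n : ℕ, 1 ≤ κ * n →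
      ‖saddleIntegral ρ n g‖ ≤ C * n ^ 2 * ‖saddleIntegral ρ n (fun _ => 1)‖ := by
    intro g hg
    obtain ⟨C, hC0, hC⟩ := exists_norm_saddleIntegral_le hρ hκ (hg.continuousOn.mono hsub)
    obtain ⟨c, hc, hle⟩ := exists_le_circleCoeff_exp_phase hρ hκ h1
    refine ⟨C / c, by positivity, fun n hn => (hC n).trans ?_⟩
    have hn' := hn0 n hn
    have e : saddleIntegral ρ n (fun _ => 1) =
        circleCoeff ρ n (fun s => Complex.exp (n * phase 1 s)) := by
      simp only [saddleIntegral, one_mul]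
    rw [e]
    calc C * (Real.exp (n * κ) / ρ ^ n) =
        C / c * n ^ 2 * (c / (n : ℝ) ^ 2 * (Real.exp (n * κ) / ρ ^ n)) := by field_simp
      _ ≤ _ := by gcongr; exact hle n hn
  simpa using step 0 (step 1 base) g hg

/-- A saddle point integral with amplitude vanishing at the saddle point is smaller by a
factor of order `n`. -/
lemma exists_norm_mul_saddleIntegral_sub_le (hρ : 0 < ρ) (hκ : κ = ρ ^ 2 * Real.exp (2 * ρ))
    (h1 : (2 + 2 * ρ) * κ = 1) {Ω : Set ℂ} (hΩ : IsOpen Ω) (hsub : Metric.sphere 0 ρ ⊆ Ω)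
    (hdiv : ∀ g : ℂ → ℂ, DifferentiableOn ℂ g Ω → ∃ h : ℂ → ℂ, DifferentiableOn ℂ h Ω ∧
      ∀ s ∈ Ω, g s = g ρ + saddleFactor s * h s) {g : ℂ → ℂ} (hg : DifferentiableOn ℂ g Ω) :
    ∃ C, 0 ≤ C ∧ ∀ n : ℕ, 1 ≤ κ * n →
      ‖n * (saddleIntegral ρ n g - g ρ * saddleIntegral ρ n (fun _ => 1))‖ ≤
        C * ‖saddleIntegral ρ n (fun _ => 1)‖ := by
  obtain ⟨h, hh, hgh⟩ := hdiv g hg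
  obtain ⟨C, hC0, hC⟩ := exists_norm_saddleIntegral_le_mul hρ hκ h1 hΩ hsub hdiv
    (differentiableOn_id.mul (hh.deriv hΩ))
  refine ⟨C, hC0, fun n hn => ?_⟩
  have e := saddleIntegral_eq_add (n := n) hρ hΩ hsub hh hgh
  rw [mul_sub, e, add_sub_cancel_left]
  exact hC n hn

end SaddleIntegral

/-! ### Asymptotics of the variance -/

section Variance

lemma exists_saddleIntegral_asymptotics : ∃ (ρ κ σsq : ℝ) (q₀ : ℂ), 0 < ρ ∧ 0 < κ ∧ 0 < σsq ∧
    q₀ ≠ 0 ∧ (∀ n : ℕ, 1 ≤ κ * n → saddleIntegral ρ n (fun _ => 1) ≠ 0) ∧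
    ∀ A₁ A₂ : ℂ → ℂ, Differentiable ℂ A₁ → Differentiable ℂ A₂ → ∃ C, 0 ≤ C ∧
      ∀ n : ℕ, 1 ≤ κ * n →
        ‖n * (circleCoeff ρ n (fun s => Complex.exp (potential 1 s + n * phase 1 s) *
          amplitude 1 s) - q₀ * saddleIntegral ρ n (fun _ => 1))‖ ≤
            C * ‖saddleIntegral ρ n (fun _ => 1)‖ ∧
        ‖circleCoeff ρ n (fun s => Complex.exp (potential 1 s + n * phase 1 s) *
          (n * ((phase 1 s - κ) * amplitude 1 s) + A₁ s))‖ ≤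
            C * ‖saddleIntegral ρ n (fun _ => 1)‖ ∧
        ‖circleCoeff ρ n (fun s => Complex.exp (potential 1 s + n * phase 1 s) *
          (n ^ 2 * ((phase 1 s - κ) ^ 2 * amplitude 1 s) +
            n * (phase 1 s * amplitude 1 s + 2 * (phase 1 s - κ) * A₁ s) + A₂ s)) -
              n * (σsq * q₀) * saddleIntegral ρ n (fun _ => 1)‖ ≤
            C * ‖saddleIntegral ρ n (fun _ => 1)‖ := by
  obtain ⟨ρ, hρ, h1⟩ := exists_saddle
  obtain ⟨κ, hκ⟩ : ∃ κ, κ = ρ ^ 2 * Real.exp (2 * ρ) := ⟨_, rfl⟩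
  rw [← hκ] at h1
  have hκ0 : 0 < κ := by rw [hκ]; positivity
  obtain ⟨Ω, hΩ, hsub, hdiv⟩ := exists_open_forall_exists_eq hρ hκ h1
  have hρΩ : (ρ : ℂ) ∈ Ω := hsub (by simp [abs_of_pos hρ])
  set b : ℝ := (2 * ρ + (2 + 2 * ρ) ^ 2) * κ with hb
  have hb0 : 0 < b := by positivity
  set T : ℂ → ℂ := fun s => Complex.exp (potential 1 s) with hT
  have hTd : Differentiable ℂ T := by fun_prop
  set q : ℂ → ℂ := fun s => T s * amplitude 1 s with hq
  have hqd : Differentiable ℂ q := by fun_prop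
  have hφρ := phase_ofReal hκ
  have hσ : 0 < κ - 1 / b := by
    rw [sub_pos, div_lt_iff₀ hb0, hb]
    have : κ * ((2 * ρ + (2 + 2 * ρ) ^ 2) * κ) = 2 * ρ * κ ^ 2 + ((2 + 2 * ρ) * κ) ^ 2 := by ring
    rw [this, h1]
    have : 0 < 2 * ρ * κ ^ 2 := by positivity
    linarith
  have hq0 : q ρ ≠ 0 := by
    refine mul_ne_zero (Complex.exp_ne_zero _) ?_
    have h1' : (2 + 2 * (ρ : ℂ)) * κ = 1 := by exact_mod_cast h1
    rw [amplitude, hφρ, h1', sub_self, mul_zero, add_zero]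
    exact_mod_cast (by positivity : ρ + 1 ≠ 0)
  have hJ : ∀ n : ℕ, 1 ≤ κ * n → saddleIntegral ρ n (fun _ => 1) ≠ 0 := by
    intro n hn h0
    obtain ⟨c, hc, hle⟩ := exists_le_circleCoeff_exp_phase hρ hκ h1
    have h := hle n hn
    simp only [saddleIntegral, one_mul] at h0
    rw [h0, norm_zero] at h
    have hn' : (n : ℝ) ≠ 0 := by
      rintro h'
      rw [h'] at hn
      norm_num at hn
    have : 0 < c / (n : ℝ) ^ 2 * (Real.exp (n * κ) / ρ ^ n) := by positivity
    linarith
  refine ⟨ρ, κ, κ - 1 / b, q ρ, hρ, hκ0, hσ, hq0, hJ, fun A₁ A₂ hA₁ hA₂ => ?_⟩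
  obtain ⟨δ, hδ, hδeq⟩ := hdiv (fun s => phase 1 s - κ) (by fun_prop)
  simp only [hφρ, sub_self, zero_add] at hδeq
  have hδρ : δ ρ * b = -1 := by
    have hφd : HasDerivAt (fun s => phase 1 s - (κ : ℂ)) _ (ρ : ℂ) :=
      (hasDerivAt_phase 1 (ρ : ℂ)).sub_const _
    have hsd := (hasDerivAt_saddleFactor hκ hρ).mul
      (hδ.differentiableAt (hΩ.mem_nhds hρΩ)).hasDerivAt
    have e := (hφd.congr_of_eventuallyEq (f₁ := saddleFactor * δ) (by
      filter_upwards [hΩ.mem_nhds hρΩ] with s hs using (hδeq s hs).symm)).unique hsd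
    rw [saddleFactor_ofReal hκ h1, zero_mul, add_zero, ← hb] at e
    have h1' : (2 + 2 * (ρ : ℂ)) * κ = 1 := by exact_mod_cast h1
    rw [← hφρ, phase] at h1'
    have hρ' : (ρ : ℂ) ≠ 0 := by exact_mod_cast hρ.ne'
    push_cast at e
    field_simp at e
    linear_combination e - h1'
  have hderiv : ρ * deriv (fun s => δ s * ((phase 1 s - κ) * q s)) ρ = -(1 / b : ℝ) * q ρ := by
    have h := (hδ.differentiableAt (hΩ.mem_nhds hρΩ)).hasDerivAt.mul
      (((hasDerivAt_phase 1 (ρ : ℂ)).sub_const (κ : ℂ)).mul (hqd ρ).hasDerivAt)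
    have h' : HasDerivAt (fun s => δ s * ((phase 1 s - κ) * q s)) _ (ρ : ℂ) := h
    have h1' : (2 + 2 * (ρ : ℂ)) * κ = 1 := by exact_mod_cast h1
    rw [← hφρ, phase] at h1'
    rw [h'.deriv]
    simp only [Pi.mul_apply, hφρ, sub_self, zero_mul, mul_zero, add_zero, zero_add]
    have hb' : (b : ℂ) ≠ 0 := by exact_mod_cast hb0.ne'
    have : δ ρ = -(1 / b : ℝ) := by
      push_cast
      field_simp
      exact hδρ
    rw [← this]
    linear_combination (δ ρ * q ρ) * h1'
  have hhd : DifferentiableOn ℂ (fun s => δ s * ((phase 1 s - κ) * q s)) Ω := by fun_prop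
  obtain ⟨C₀, hC₀, b₀⟩ := exists_norm_mul_saddleIntegral_sub_le hρ hκ h1 hΩ hsub hdiv
    hqd.differentiableOn
  obtain ⟨C₁, hC₁, b₁⟩ := exists_norm_mul_saddleIntegral_sub_le hρ hκ h1 hΩ hsub hdiv
    (g := fun s => (phase 1 s - κ) * q s) (by fun_prop)
  obtain ⟨C₂, hC₂, b₂⟩ := exists_norm_saddleIntegral_le_mul hρ hκ h1 hΩ hsub hdiv
    (g := fun s => T s * A₁ s) (by fun_prop)
  obtain ⟨C₃, hC₃, b₃⟩ := exists_norm_mul_saddleIntegral_sub_le hρ hκ h1 hΩ hsub hdiv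
    (g := fun s => s * deriv (fun s => δ s * ((phase 1 s - κ) * q s)) s)
    (differentiableOn_id.mul (hhd.deriv hΩ))
  obtain ⟨C₄, hC₄, b₄⟩ := exists_norm_mul_saddleIntegral_sub_le hρ hκ h1 hΩ hsub hdiv
    (g := fun s => phase 1 s * q s + 2 * (phase 1 s - κ) * (T s * A₁ s)) (by fun_prop)
  obtain ⟨C₅, hC₅, b₅⟩ := exists_norm_saddleIntegral_le_mul hρ hκ h1 hΩ hsub hdiv
    (g := fun s => T s * A₂ s) (by fun_prop)
  refine ⟨C₀ + (C₁ + C₂) + (C₃ + C₄ + C₅), by positivity, fun n hn => ?_⟩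
  have hφc := (differentiable_phase 1).continuous
  have hqc := hqd.continuous
  have hTc := hTd.continuous
  have hA₁c := hA₁.continuous
  have hA₂c := hA₂.continuous
  have hJ0 := norm_nonneg (saddleIntegral ρ n (fun _ => 1))
  have hmono : ∀ {x c : ℝ}, x ≤ c * ‖saddleIntegral ρ n (fun _ => 1)‖ →
      c ≤ C₀ + (C₁ + C₂) + (C₃ + C₄ + C₅) → x ≤ (C₀ + (C₁ + C₂) + (C₃ + C₄ + C₅)) *
        ‖saddleIntegral ρ n (fun _ => 1)‖ := fun hx hc =>
    hx.trans (mul_le_mul_of_nonneg_right hc hJ0)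
  have hI : ∀ g : ℂ → ℂ, circleCoeff ρ n (fun s => Complex.exp (potential 1 s + n * phase 1 s) *
      g s) = saddleIntegral ρ n (fun s => T s * g s) := by
    intro g
    simp only [saddleIntegral, hT, Complex.exp_add, mul_right_comm]
  have hsf := differentiable_saddleFactor.continuous
  have hδc : ContinuousOn δ (Metric.sphere 0 ρ) := hδ.continuousOn.mono hsub
  have r₁ : circleCoeff ρ n (fun s => Complex.exp (potential 1 s + n * phase 1 s) *
      (n * ((phase 1 s - κ) * amplitude 1 s) + A₁ s)) =
      n * saddleIntegral ρ n (fun s => (phase 1 s - κ) * q s) +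
        saddleIntegral ρ n (fun s => T s * A₁ s) := by
    rw [hI, ← saddleIntegral_const_mul, ← saddleIntegral_add hρ (by fun_prop) (by fun_prop)]
    congr 1
    ext s
    simp only [hq]
    ring
  have r₂ : circleCoeff ρ n (fun s => Complex.exp (potential 1 s + n * phase 1 s) *
      (n ^ 2 * ((phase 1 s - κ) ^ 2 * amplitude 1 s) +
        n * (phase 1 s * amplitude 1 s + 2 * (phase 1 s - κ) * A₁ s) + A₂ s)) =
      n * saddleIntegral ρ n (fun s => s * deriv (fun s => δ s * ((phase 1 s - κ) * q s)) s) +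
        n * saddleIntegral ρ n (fun s => phase 1 s * q s + 2 * (phase 1 s - κ) * (T s * A₁ s)) +
          saddleIntegral ρ n (fun s => T s * A₂ s) := by
    rw [hI, ← saddleIntegral_saddleFactor_mul hρ hΩ hsub hhd, ← saddleIntegral_const_mul,
      ← saddleIntegral_const_mul, ← saddleIntegral_const_mul,
      ← saddleIntegral_add hρ (by fun_prop) (by fun_prop),
      ← saddleIntegral_add hρ (by fun_prop) (by fun_prop)]
    refine saddleIntegral_congr hρ fun s hs => ?_
    simp only [hq]
    linear_combination (n ^ 2 * (T s * amplitude 1 s) * (phase 1 s - κ)) * hδeq s (hsub hs)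
  refine ⟨?_, ?_, ?_⟩
  · rw [hI]
    exact hmono (b₀ n hn) (by linarith)
  · rw [r₁]
    have h := b₁ n hn
    simp only [hφρ, sub_self, zero_mul, sub_zero] at h
    refine hmono (c := C₁ + C₂) ((norm_add_le _ _).trans ?_) (by linarith)
    rw [add_mul]
    exact add_le_add h (b₂ n hn)
  · have h₃ := b₃ n hn
    have h₄ := b₄ n hn
    rw [hderiv] at h₃
    simp only [hφρ, sub_self, mul_zero, zero_mul, add_zero] at h₄
    refine hmono (c := C₃ + C₄ + C₅) (le_trans (le_of_eq ?_) ((norm_add₃_le).trans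
      ((add_le_add (add_le_add h₃ h₄) (b₅ n hn)).trans_eq (by ring)))) (by linarith)
    congr 1
    rw [r₂]
    push_cast
    ring

end Variance

section Conclusion

lemma Vbar_eq_centred (n : ℕ) [Fintype (MMSpace n)] (h0 : (mN n : ℝ) ≠ 0) (a : ℝ) :
    Vbar n = (∑ p : MMSpace n, ((p.val.2.ncard : ℝ) - a) ^ 2) / mN n -
      ((∑ p : MMSpace n, ((p.val.2.ncard : ℝ) - a)) / mN n) ^ 2 := by
  have hc : (mN n : ℝ) = ∑ _p : MMSpace n, (1 : ℝ) := by
    simp [mN, Nat.card_eq_fintype_card]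
  have e : ∑ p : MMSpace n, ((p.val.2.ncard : ℝ) - a) ^ 2 =
      ∑ p : MMSpace n, (p.val.2.ncard : ℝ) ^ 2 - 2 * a * ∑ p : MMSpace n, (p.val.2.ncard : ℝ) +
        a ^ 2 * mN n := by
    rw [hc, Finset.mul_sum, Finset.mul_sum, ← Finset.sum_sub_distrib, ← Finset.sum_add_distrib]
    exact Finset.sum_congr rfl fun p _ => by ring
  have e1 : ∑ p : MMSpace n, ((p.val.2.ncard : ℝ) - a) =
      ∑ p : MMSpace n, (p.val.2.ncard : ℝ) - a * mN n := by
    rw [hc, Finset.mul_sum, ← Finset.sum_sub_distrib]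
    simp only [mul_one]
  rw [Vbar, Ebar, finsum_eq_sum_of_fintype, finsum_eq_sum_of_fintype, e, e1]
  field_simp
  ring

lemma exists_eventually_abs_Vbar_sub_le : ∃ σsq K : ℝ, 0 < σsq ∧
    ∀ᶠ n : ℕ in atTop, |Vbar n - σsq * n| ≤ K := by
  obtain ⟨ρ, κ, σsq, q₀, hρ, hκ, hσ, hq₀, hJ, hasym⟩ := exists_saddleIntegral_asymptotics
  obtain ⟨A₁, A₂, hA₁, hA₂, hmom⟩ := exists_moment_integrals hρ (κ : ℂ)
  obtain ⟨C, hC, hb⟩ := hasym A₁ A₂ hA₁ hA₂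
  have hq₀' : 0 < ‖q₀‖ := norm_pos_iff.2 hq₀
  set K := 2 * (C + σsq * C) / ‖q₀‖ with hK
  have hK0 : 0 ≤ K := by positivity
  refine ⟨σsq, K + K ^ 2, hσ, ?_⟩
  filter_upwards [tendsto_natCast_atTop_atTop.eventually_ge_atTop (1 / κ),
    tendsto_natCast_atTop_atTop.eventually_ge_atTop (2 * C / ‖q₀‖), eventually_gt_atTop 0]
    with n hn1 hn2 hn0
  rw [div_le_iff₀' hκ] at hn1
  rw [div_le_iff₀ hq₀'] at hn2
  have : Fintype (MMSpace n) := Fintype.ofFinite _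
  obtain ⟨m₁, m₂⟩ := hmom n
  have m₀ := sum_pow_ncard hρ 1 n
  obtain ⟨b₀, b₁, b₂⟩ := hb n hn1
  have hJ0 : 0 < ‖saddleIntegral ρ n (fun _ => 1)‖ := norm_pos_iff.2 (hJ n hn1)
  set J := saddleIntegral ρ n (fun _ => 1)
  set R₀ := circleCoeff ρ n (fun s => Complex.exp (potential 1 s + n * phase 1 s) * amplitude 1 s)
  set R₁ := circleCoeff ρ n (fun s => Complex.exp (potential 1 s + n * phase 1 s) *
    (n * ((phase 1 s - κ) * amplitude 1 s) + A₁ s))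
  set R₂ := circleCoeff ρ n (fun s => Complex.exp (potential 1 s + n * phase 1 s) *
    (n ^ 2 * ((phase 1 s - κ) ^ 2 * amplitude 1 s) +
      n * (phase 1 s * amplitude 1 s + 2 * (phase 1 s - κ) * A₁ s) + A₂ s))
  set S₁ : ℝ := ∑ p : MMSpace n, ((p.val.2.ncard : ℝ) - n * κ) with hS₁
  set S₂ : ℝ := ∑ p : MMSpace n, ((p.val.2.ncard : ℝ) - n * κ) ^ 2 with hS₂
  have hn0' : (0 : ℝ) < n := by exact_mod_cast hn0
  have hnC : (n : ℂ) ≠ 0 := by exact_mod_cast hn0.ne'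
  have hfac : (n.factorial : ℂ) ≠ 0 := by exact_mod_cast n.factorial_ne_zero
  have m₀' : (n : ℂ) ^ 2 * (mN n : ℝ) = n.factorial * R₀ := by
    rw [← m₀]
    simp [mN, Nat.card_eq_fintype_card]
  have m₁' : (n : ℂ) ^ 2 * (S₁ : ℝ) = n.factorial * R₁ := by
    rw [← m₁, hS₁]
    push_cast
    rfl
  have m₂' : (n : ℂ) ^ 2 * (S₂ : ℝ) = n.factorial * R₂ := by
    rw [← m₂, hS₂]
    push_cast
    rfl
  have hR₀ : ‖J‖ ≤ 2 / ‖q₀‖ * ‖R₀‖ := by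
    rw [norm_mul, Complex.norm_natCast] at b₀
    have h1 : ‖q₀‖ * ‖J‖ ≤ ‖R₀‖ + ‖R₀ - q₀ * J‖ := by
      rw [← norm_mul, ← norm_neg (R₀ - _), neg_sub]
      simpa using norm_add_le R₀ (q₀ * J - R₀)
    have h2 : ‖R₀ - q₀ * J‖ ≤ ‖q₀‖ * ‖J‖ / 2 := by
      refine le_of_mul_le_mul_left (b₀.trans ?_) hn0'
      nlinarith
    rw [div_mul_eq_mul_div, le_div_iff₀ hq₀']
    linarith
  have hR₀0 : 0 < ‖R₀‖ := by
    by_contra! h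
    have : 2 / ‖q₀‖ * ‖R₀‖ ≤ 0 := mul_nonpos_of_nonneg_of_nonpos (by positivity) h
    linarith
  have hm0 : (mN n : ℝ) ≠ 0 := by
    intro h
    rw [h, Complex.ofReal_zero, mul_zero] at m₀'
    exact (mul_ne_zero hfac (norm_pos_iff.1 hR₀0)) m₀'.symm
  have hm0' : (0 : ℝ) < mN n := (Nat.cast_nonneg _).lt_of_ne' hm0
  have hratio : ∀ (S : ℝ) (R : ℂ), (n : ℂ) ^ 2 * (S : ℝ) = n.factorial * R →
      ‖R‖ ≤ (C + σsq * C) * ‖J‖ → |S / mN n| ≤ K := by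
    intro S R hSR hR
    have h1 : (S : ℂ) * R₀ = R * (mN n : ℝ) := by
      refine mul_left_cancel₀ (mul_ne_zero hfac (pow_ne_zero 2 hnC)) ?_
      linear_combination (n.factorial * R₀) * hSR - (n.factorial * R) * m₀'
    have h2 := congrArg norm h1
    rw [norm_mul, norm_mul, Complex.norm_real, Complex.norm_real, Real.norm_eq_abs,
      Real.norm_of_nonneg hm0'.le] at h2
    rw [abs_div, abs_of_pos hm0', div_le_iff₀ hm0']
    refine le_of_mul_le_mul_right ?_ hR₀0
    calc |S| * ‖R₀‖ = ‖R‖ * mN n := h2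
      _ ≤ (C + σsq * C) * (2 / ‖q₀‖ * ‖R₀‖) * mN n := by
        gcongr
        exact hR.trans (by gcongr)
      _ = K * mN n * ‖R₀‖ := by rw [hK]; ring
  have f₁ : |S₁ / mN n| ≤ K := by
    refine hratio S₁ R₁ m₁' (b₁.trans ?_)
    gcongr
    have : 0 ≤ σsq * C := by positivity
    linarith
  have f₂ : |S₂ / mN n - σsq * n| ≤ K := by
    have := hratio (S₂ - σsq * n * mN n) (R₂ - σsq * n * R₀) (by
      push_cast
      push_cast at m₀'
      linear_combination m₂' - (σsq * n) * m₀') (by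
      have e : R₂ - σsq * n * R₀ = (R₂ - n * (σsq * q₀) * J) -
        σsq * (n * (R₀ - q₀ * J)) := by ring
      rw [e, add_mul, mul_assoc σsq]
      refine (norm_sub_le _ _).trans (add_le_add b₂ ?_)
      rw [norm_mul, Complex.norm_real, Real.norm_of_nonneg hσ.le]
      gcongr)
    rwa [sub_div, mul_div_cancel_right₀ _ hm0] at this
  rw [Vbar_eq_centred n hm0 (n * κ), ← hS₁, ← hS₂, sub_right_comm]
  refine (abs_sub _ _).trans (add_le_add f₂ ?_)
  rw [abs_pow]
  gcongr

end Conclusion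

theorem stmt_17 :
    ∃ σsq K : ℝ, 0 < σsq ∧ 0 ≤ K ∧
      ∀ n : ℕ, 1 ≤ n → |Vbar n - σsq * (n : ℝ)| ≤ K := by
  obtain ⟨σsq, K, hσ, h⟩ := exists_eventually_abs_Vbar_sub_le
  obtain ⟨N, hN⟩ := eventually_atTop.1 h
  have hs : ∀ n ∈ Finset.range N, 0 ≤ |Vbar n - σsq * n| := fun n _ => abs_nonneg _
  refine ⟨σsq, |K| + ∑ n ∈ Finset.range N, |Vbar n - σsq * n|, hσ,
    add_nonneg (abs_nonneg K) (Finset.sum_nonneg hs), fun n _ => ?_⟩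
  rcases le_or_gt N n with hn | hn
  · exact (hN n hn).trans ((le_abs_self K).trans (le_add_of_nonneg_right (Finset.sum_nonneg hs)))
  · exact (Finset.single_le_sum hs (Finset.mem_range.2 hn)).trans
      (le_add_of_nonneg_left (abs_nonneg K))
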